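/- arXiv:1601.07359 — 2 statements merged into one kernel-verified Lean document; each statement's English description precedes it below -/
import Mathlib

section
/- For all integers p, q ≥ 2 with (p,q) ≠ (2,2), the irreducible symmetric space SO(p+q,ℂ)/SO₀(p,q) does not admit a compact Clifford–Klein form; that is, there is no discrete subgroup Γ of SO(p+q,ℂ) whose left-translation action on SO(p+q,ℂ)/SO₀(p,q) is properly discontinuous and free and has compact quotient. -/
/-! Statement 6: For all integers `p, q ≥ 2` with `(p,q) ≠ (2,2)`, the irreducible
symmetric space `SO(p+q,ℂ)/SO₀(p,q)` does not admit a compact Clifford–Klein form. -/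

open Matrix

noncomputable section

/-- A homogeneous space `G/H` admits a compact Clifford–Klein form if there is a discrete
subgroup `Γ` of `G` acting properly discontinuously and freely on `G/H` by left translations
with compact quotient `Γ\G/H`. -/
def AdmitsCompactCliffordKleinForm {G : Type*} [Group G] [TopologicalSpace G]
    (H : Subgroup G) : Prop :=
  ∃ Γ : Subgroup G, DiscreteTopology Γ ∧
    ProperlyDiscontinuousSMul Γ (G ⧸ H) ∧
    (∀ γ : Γ, γ ≠ 1 → ∀ x : G ⧸ H, γ • x ≠ x) ∧
    CompactSpace (Quotient (MulAction.orbitRel Γ (G ⧸ H)))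

/-- The matrix `I_{p,q} = diag(1,…,1,−1,…,−1)` (`p` ones, `q` minus ones). -/
def formMat (p q : ℕ) : Matrix (Fin (p + q)) (Fin (p + q)) ℝ :=
  Matrix.diagonal fun i => if (i : ℕ) < p then (1 : ℝ) else -1

/-- The indefinite orthogonal group `O(p,q)`, as a subgroup of `GL(p+q, ℝ)`:
the group of matrices `A` with `Aᵀ I_{p,q} A = I_{p,q}`. -/
def indefO (p q : ℕ) : Subgroup (GL (Fin (p + q)) ℝ) where
  carrier := {A | (A : Matrix (Fin (p + q)) (Fin (p + q)) ℝ)ᵀ * formMat p q * A = formMat p q}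
  one_mem' := by simp
  mul_mem' := by
    intro a b ha hb
    have h : ((a * b : GL (Fin (p + q)) ℝ) : Matrix (Fin (p + q)) (Fin (p + q)) ℝ)ᵀ *
        formMat p q * ((a * b : GL (Fin (p + q)) ℝ) : Matrix (Fin (p + q)) (Fin (p + q)) ℝ) =
        (b : Matrix (Fin (p + q)) (Fin (p + q)) ℝ)ᵀ *
          ((a : Matrix (Fin (p + q)) (Fin (p + q)) ℝ)ᵀ * formMat p q *
            (a : Matrix (Fin (p + q)) (Fin (p + q)) ℝ)) *
          (b : Matrix (Fin (p + q)) (Fin (p + q)) ℝ) := by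
      rw [Units.val_mul, Matrix.transpose_mul]
      simp only [mul_assoc]
    show _ = _
    rw [h, ha, hb]
  inv_mem' := by
    intro a ha
    have h1 : (a : Matrix (Fin (p + q)) (Fin (p + q)) ℝ) *
        ((a⁻¹ : GL (Fin (p + q)) ℝ) : Matrix (Fin (p + q)) (Fin (p + q)) ℝ) = 1 := by
      rw [← Units.val_mul, mul_inv_cancel, Units.val_one]
    have key : ((a⁻¹ : GL (Fin (p + q)) ℝ) : Matrix (Fin (p + q)) (Fin (p + q)) ℝ)ᵀ *
        ((a : Matrix (Fin (p + q)) (Fin (p + q)) ℝ)ᵀ * formMat p q *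
          (a : Matrix (Fin (p + q)) (Fin (p + q)) ℝ)) *
        ((a⁻¹ : GL (Fin (p + q)) ℝ) : Matrix (Fin (p + q)) (Fin (p + q)) ℝ) = formMat p q := by
      have h2 : ((a⁻¹ : GL (Fin (p + q)) ℝ) : Matrix (Fin (p + q)) (Fin (p + q)) ℝ)ᵀ *
          ((a : Matrix (Fin (p + q)) (Fin (p + q)) ℝ)ᵀ * formMat p q *
            (a : Matrix (Fin (p + q)) (Fin (p + q)) ℝ)) *
          ((a⁻¹ : GL (Fin (p + q)) ℝ) : Matrix (Fin (p + q)) (Fin (p + q)) ℝ) =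
          ((a : Matrix (Fin (p + q)) (Fin (p + q)) ℝ) *
            ((a⁻¹ : GL (Fin (p + q)) ℝ) : Matrix (Fin (p + q)) (Fin (p + q)) ℝ))ᵀ *
            formMat p q *
            ((a : Matrix (Fin (p + q)) (Fin (p + q)) ℝ) *
              ((a⁻¹ : GL (Fin (p + q)) ℝ) : Matrix (Fin (p + q)) (Fin (p + q)) ℝ)) := by
        rw [Matrix.transpose_mul]
        simp only [mul_assoc]
      rw [h2, h1]
      simp
    replace ha : (a : Matrix (Fin (p + q)) (Fin (p + q)) ℝ)ᵀ * formMat p q *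
        (a : Matrix (Fin (p + q)) (Fin (p + q)) ℝ) = formMat p q := ha
    rw [ha] at key
    exact key
  
/-- `SO₀(p,q)`: the identity component of `O(p,q)`, as a subgroup of `GL(p+q,ℝ)`. -/
def SOZero (p q : ℕ) : Subgroup (GL (Fin (p + q)) ℝ) :=
  Subgroup.map (indefO p q).subtype
    (Subgroup.connectedComponentOfOne (indefO p q))

/-- The complex special orthogonal group `SO(n,ℂ)`: complex `n×n` matrices `A` with
`Aᵀ A = 1` and `det A = 1`. -/
def SOC (n : ℕ) : Subgroup (GL (Fin n) ℂ) where
  carrier := {A | (A : Matrix (Fin n) (Fin n) ℂ)ᵀ * A = 1 ∧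
    (A : Matrix (Fin n) (Fin n) ℂ).det = 1}
  one_mem' := by constructor <;> simp
  mul_mem' := by
    intro a b ha hb
    obtain ⟨ha1, ha2⟩ := ha
    obtain ⟨hb1, hb2⟩ := hb
    refine ⟨?_, ?_⟩
    · have h : ((a * b : GL (Fin n) ℂ) : Matrix (Fin n) (Fin n) ℂ)ᵀ *
          ((a * b : GL (Fin n) ℂ) : Matrix (Fin n) (Fin n) ℂ) =
          (b : Matrix (Fin n) (Fin n) ℂ)ᵀ *
            ((a : Matrix (Fin n) (Fin n) ℂ)ᵀ * (a : Matrix (Fin n) (Fin n) ℂ)) *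
            (b : Matrix (Fin n) (Fin n) ℂ) := by
        rw [Units.val_mul, Matrix.transpose_mul]
        simp only [mul_assoc]
      show _ = _
      rw [h, ha1, mul_one, hb1]
    · show ((a * b : GL (Fin n) ℂ) : Matrix (Fin n) (Fin n) ℂ).det = 1
      rw [Units.val_mul, Matrix.det_mul, ha2, hb2, mul_one]
  inv_mem' := by
    intro a ha
    obtain ⟨ha1, ha2⟩ := ha
    have h1 : (a : Matrix (Fin n) (Fin n) ℂ) *
        ((a⁻¹ : GL (Fin n) ℂ) : Matrix (Fin n) (Fin n) ℂ) = 1 := by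
      rw [← Units.val_mul, mul_inv_cancel, Units.val_one]
    refine ⟨?_, ?_⟩
    · have key : ((a⁻¹ : GL (Fin n) ℂ) : Matrix (Fin n) (Fin n) ℂ)ᵀ *
          ((a : Matrix (Fin n) (Fin n) ℂ)ᵀ * (a : Matrix (Fin n) (Fin n) ℂ)) *
          ((a⁻¹ : GL (Fin n) ℂ) : Matrix (Fin n) (Fin n) ℂ) =
          ((a : Matrix (Fin n) (Fin n) ℂ) *
            ((a⁻¹ : GL (Fin n) ℂ) : Matrix (Fin n) (Fin n) ℂ))ᵀ *
            ((a : Matrix (Fin n) (Fin n) ℂ) *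
              ((a⁻¹ : GL (Fin n) ℂ) : Matrix (Fin n) (Fin n) ℂ)) := by
        rw [Matrix.transpose_mul]
        simp only [mul_assoc]
      rw [ha1, mul_one, h1] at key
      show _ = _
      rw [key]
      simp
    · have hd : (a : Matrix (Fin n) (Fin n) ℂ).det *
          ((a⁻¹ : GL (Fin n) ℂ) : Matrix (Fin n) (Fin n) ℂ).det = 1 := by
        rw [← Matrix.det_mul, h1, Matrix.det_one]
      show ((a⁻¹ : GL (Fin n) ℂ) : Matrix (Fin n) (Fin n) ℂ).det = 1
      rw [ha2, one_mul] at hd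
      exact hd

/-- The diagonal matrix `D = diag(1_p, √−1·1_q)`, as a unit of the ring of complex
`(p+q)×(p+q)` matrices (its inverse is `diag(1_p, −√−1·1_q)`). -/
def Dunit (p q : ℕ) : (Matrix (Fin (p + q)) (Fin (p + q)) ℂ)ˣ where
  val := Matrix.diagonal fun i => if (i : ℕ) < p then (1 : ℂ) else Complex.I
  inv := Matrix.diagonal fun i => if (i : ℕ) < p then (1 : ℂ) else -Complex.I
  val_inv := by
    rw [Matrix.diagonal_mul_diagonal]
    convert Matrix.diagonal_one
    rename_i i
    by_cases h : (i : ℕ) < p <;> simp [h, Complex.I_mul_I]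
  inv_val := by
    rw [Matrix.diagonal_mul_diagonal]
    convert Matrix.diagonal_one
    rename_i i
    by_cases h : (i : ℕ) < p <;> simp [h, Complex.I_mul_I]

/-- Conjugation `x ↦ u x u⁻¹` by a unit `u`, as a monoid homomorphism. -/
def conjByUnit {M : Type*} [Monoid M] (u : Mˣ) : M →* M where
  toFun x := (u : M) * x * ((u⁻¹ : Mˣ) : M)
  map_one' := by simp
  map_mul' x y := by
    simp only [mul_assoc, Units.inv_mul_cancel_left]

/-- The embedding of real `(p+q)×(p+q)` matrices into complex ones given by
`A ↦ D A D⁻¹` with `D = diag(1_p, √−1·1_q)` (a homomorphism of multiplicative monoids). -/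
def embedDconj (p q : ℕ) :
    Matrix (Fin (p + q)) (Fin (p + q)) ℝ →* Matrix (Fin (p + q)) (Fin (p + q)) ℂ :=
  (conjByUnit (Dunit p q)).comp
    (RingHom.toMonoidHom (Complex.ofRealHom.mapMatrix :
      Matrix (Fin (p + q)) (Fin (p + q)) ℝ →+* Matrix (Fin (p + q)) (Fin (p + q)) ℂ))


/-- Normal form of skew operators. -/
lemma skew_pairs {E : Type*} [NormedAddCommGroup E] [InnerProductSpace ℝ E]
    [FiniteDimensional ℝ E] : ∀ (k : ℕ) (T : E →ₗ[ℝ] E)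
    (_ : ∀ x y, inner ℝ (T x) y = - inner ℝ x (T y))
    (_ : Module.finrank ℝ (LinearMap.range T) ≤ k),
    ∃ (r : ℕ) (u v : ℕ → E) (t : ℕ → ℝ),
      (∀ i < r, ∀ j < r, inner ℝ (u i) (u j) = if i = j then (1:ℝ) else 0) ∧
      (∀ i < r, ∀ j < r, inner ℝ (v i) (v j) = if i = j then (1:ℝ) else 0) ∧
      (∀ i < r, ∀ j < r, inner ℝ (u i) (v j) = (0:ℝ)) ∧
      (∀ i < r, t i ≠ 0) ∧
      (∀ i < r, T (u i) = t i • v i) ∧ (∀ i < r, T (v i) = - t i • u i) ∧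
      (∀ x, (∀ i < r, inner ℝ (u i) x = (0:ℝ) ∧ inner ℝ (v i) x = (0:ℝ)) → T x = 0) := by
  intro k
  induction k with
  | zero =>
    intro T _ hr
    have h0 : T = 0 := by
      have : LinearMap.range T = ⊥ := Submodule.finrank_eq_zero.mp (by omega)
      exact LinearMap.range_eq_bot.mp this
    exact ⟨0, fun _ => 0, fun _ => 0, fun _ => 0, by simp, by simp, by simp, by simp, by simp,
      by simp, by simp [h0]⟩
  | succ k ih =>
    intro T hT hr
    by_cases h0 : T = 0
    · exact ⟨0, fun _ => 0, fun _ => 0, fun _ => 0, by simp, by simp, by simp, by simp, by simp,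
        by simp, by simp [h0]⟩
    -- an eigenvector of T²
    have hsym : (T ∘ₗ T).IsSymmetric := by
      intro x y
      simp only [LinearMap.comp_apply]
      rw [hT, hT, neg_neg]
    obtain ⟨e, lam, hlam, hen, hee⟩ : ∃ (e : E) (lam : ℝ), lam ≠ 0 ∧ inner ℝ e e = (1:ℝ) ∧
        T (T e) = lam • e := by
      by_contra hcon
      push Not at hcon
      apply h0
      have hb := fun i => hsym.apply_eigenvectorBasis rfl i
      have hz : T ∘ₗ T = 0 := by
        apply (hsym.eigenvectorBasis rfl).toBasis.ext
        intro i
        have h1 := hb i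
        by_cases hl : hsym.eigenvalues rfl i = 0
        · simp only [OrthonormalBasis.coe_toBasis, h1, hl]; simp
        · exfalso
          refine hcon (hsym.eigenvectorBasis rfl i) _ hl ?_ h1
          rw [real_inner_self_eq_norm_sq, (hsym.eigenvectorBasis rfl).orthonormal.1 i]; norm_num
      ext x
      have h2 : inner ℝ (T x) (T x) = (0:ℝ) := by
        rw [hT, ← LinearMap.comp_apply, hz]; simp
      simpa using h2
    have hself : ∀ x, inner ℝ x (T x) = (0:ℝ) := by
      intro x
      have := hT x x
      rw [real_inner_comm] at this
      linarith
    have hTe : inner ℝ (T e) (T e) = -lam := by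
      rw [hT, hee, inner_smul_right, hen]; ring
    set t0 : ℝ := ‖T e‖ with ht0
    have ht2 : t0 ^ 2 = -lam := by rw [ht0, ← real_inner_self_eq_norm_sq, hTe]
    have htne : t0 ≠ 0 := by
      intro h; rw [h] at ht2; apply hlam; linarith
    set f : E := t0⁻¹ • T e with hf
    have hTe' : T e = t0 • f := by rw [hf, smul_smul, mul_inv_cancel₀ htne, one_smul]
    have hTf : T f = - t0 • e := by
      rw [hf, map_smul, hee, smul_smul]
      congr 1
      have : lam = -t0^2 := by linarith
      rw [this]; field_simp
    have hff : inner ℝ f f = (1:ℝ) := by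
      rw [hf, inner_smul_left, inner_smul_right, hTe, ← ht2]
      simp; field_simp
    have hef : inner ℝ e f = (0:ℝ) := by
      rw [hf, inner_smul_right, hself, mul_zero]
    have hfe : inner ℝ f e = (0:ℝ) := by rw [real_inner_comm, hef]
    let T' : E →ₗ[ℝ] E := T - t0 • ((innerₛₗ ℝ e).smulRight f - (innerₛₗ ℝ f).smulRight e)
    have hT'a : ∀ x, T' x = T x - t0 • ((inner ℝ e x : ℝ) • f - (inner ℝ f x : ℝ) • e) := by
      intro x; simp [T']
    have hT' : ∀ x y, inner ℝ (T' x) y = - inner ℝ x (T' y) := by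
      intro x y
      simp only [hT'a, inner_sub_left, inner_sub_right, inner_smul_left, inner_smul_right, hT x y]
      rw [real_inner_comm e x, real_inner_comm f x]
      simp
      ring
    have hT'e : T' e = 0 := by
      rw [hT'a, hen, hfe, hTe']; simp
    have hT'f : T' f = 0 := by
      rw [hT'a, hff, hef, hTf]; simp
    have hrange : LinearMap.range T' < LinearMap.range T := by
      refine lt_of_le_of_ne ?_ ?_
      · rintro _ ⟨x, rfl⟩
        rw [hT'a]
        refine Submodule.sub_mem _ ⟨x, rfl⟩ (Submodule.smul_mem _ _ (Submodule.sub_mem _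
          (Submodule.smul_mem _ _ ?_) (Submodule.smul_mem _ _ ?_)))
        · exact Submodule.smul_mem _ _ ⟨e, rfl⟩
        · refine ⟨(- t0)⁻¹ • f, ?_⟩
          rw [map_smul, hTf, smul_smul, inv_mul_cancel₀ (by simpa using htne), one_smul]
      · intro heq
        have : f ∈ LinearMap.range T' := by
          rw [heq]; exact Submodule.smul_mem _ _ ⟨e, rfl⟩
        obtain ⟨x, hx⟩ := this
        have h1 : inner ℝ (T' x) f = (0:ℝ) := by rw [hT', hT'f]; simp
        rw [hx, hff] at h1
        exact one_ne_zero h1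
    have hfr := Submodule.finrank_lt_finrank_of_lt hrange
    obtain ⟨r, u, v, t, huu, hvv, huv, ht, hu, hv, hker⟩ := ih T' hT' (by omega)
    have hperp : ∀ y, T' y = 0 → ∀ i < r, inner ℝ (u i) y = (0:ℝ) ∧ inner ℝ (v i) y = (0:ℝ) := by
      intro y hy i hi
      constructor
      · have h1 : inner ℝ (T' (v i)) y = (0:ℝ) := by rw [hT', hy]; simp
        rw [hv i hi, inner_smul_left] at h1
        simpa [ht i hi] using h1
      · have h1 : inner ℝ (T' (u i)) y = (0:ℝ) := by rw [hT', hy]; simp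
        rw [hu i hi, inner_smul_left] at h1
        simpa [ht i hi] using h1
    have hpe := hperp e hT'e
    have hpf := hperp f hT'f
    have hTT : ∀ x, inner ℝ e x = (0:ℝ) → inner ℝ f x = (0:ℝ) → T x = T' x := by
      intro x h1 h2
      rw [hT'a, h1, h2]; simp
    refine ⟨r + 1, fun i => if i = r then e else u i, fun i => if i = r then f else v i,
      fun i => if i = r then t0 else t i, ?_, ?_, ?_, ?_, ?_, ?_, ?_⟩
    · intro i hi j hj
      by_cases h1 : i = r <;> by_cases h2 : j = r
      · simp only [h1, h2, if_true, hen]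
      · have := (hpe j (by omega)).1
        rw [real_inner_comm] at this
        simp [h1, h2, this, Ne.symm h2]
      · simp [h1, h2, (hpe i (by omega)).1]
      · simp only [h1, h2, if_false]; exact huu i (by omega) j (by omega)
    · intro i hi j hj
      by_cases h1 : i = r <;> by_cases h2 : j = r
      · simp only [h1, h2, if_true, hff]
      · have := (hpf j (by omega)).2
        rw [real_inner_comm] at this
        simp [h1, h2, this, Ne.symm h2]
      · simp [h1, h2, (hpf i (by omega)).2]
      · simp only [h1, h2, if_false]; exact hvv i (by omega) j (by omega)
    · intro i hi j hj
      by_cases h1 : i = r <;> by_cases h2 : j = r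
      · simp [h1, h2, hef]
      · have := (hpe j (by omega)).2
        rw [real_inner_comm] at this
        simp [h1, h2, this]
      · simp [h1, h2, (hpf i (by omega)).1]
      · simp only [h1, h2, if_false]; exact huv i (by omega) j (by omega)
    · intro i hi
      by_cases h1 : i = r
      · simp [h1, htne]
      · simp only [h1, if_false]; exact ht i (by omega)
    · intro i hi
      by_cases h1 : i = r
      · simp [h1, hTe']
      · simp only [h1, if_false]
        rw [hTT, hu i (by omega)]
        · rw [real_inner_comm]; exact (hpe i (by omega)).1
        · rw [real_inner_comm]; exact (hpf i (by omega)).1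
    · intro i hi
      by_cases h1 : i = r
      · simp [h1, hTf]
      · simp only [h1, if_false]
        rw [hTT, hv i (by omega)]
        · rw [real_inner_comm]; exact (hpe i (by omega)).2
        · rw [real_inner_comm]; exact (hpf i (by omega)).2
    · intro x hx
      have hr0 := hx r (by omega)
      simp only [if_true] at hr0
      rw [hTT x hr0.1 hr0.2]
      apply hker
      intro i hi
      have := hx i (by omega)
      simpa [show i ≠ r by omega] using this

/-- A monomial matrix with entries `c i` at `(i, σ i)`. -/
def monoMat {n : ℕ} (σ : Fin n → Fin n) (c : Fin n → ℝ) : Matrix (Fin n) (Fin n) ℝ :=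
  Matrix.of fun i j => if j = σ i then c i else 0

lemma skew_normal_matrix (p q : ℕ) (hp : 0 < p) (T : Matrix (Fin (p + q)) (Fin (p + q)) ℝ)
    (hT : Tᵀ = -T) (hr : T.rank ≤ 2 * min p q) :
    ∃ (O : Matrix (Fin (p + q)) (Fin (p + q)) ℝ) (σ : Fin (p + q) → Fin (p + q))
      (c : Fin (p + q) → ℝ), O * Oᵀ = 1 ∧ O.det = 1 ∧ Function.Involutive σ ∧
      (∀ i, c (σ i) = - c i) ∧ (∀ i, c i ≠ 0 → (((i : ℕ) < p) ↔ ¬ ((σ i : ℕ) < p))) ∧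
      O * T * Oᵀ = monoMat σ c := by
  suffices H : ∃ (O : Matrix (Fin (p + q)) (Fin (p + q)) ℝ) (σ : Fin (p + q) → Fin (p + q))
      (c : Fin (p + q) → ℝ), O * Oᵀ = 1 ∧ Function.Involutive σ ∧
      (∀ i, c (σ i) = - c i) ∧ (∀ i, c i ≠ 0 → (((i : ℕ) < p) ↔ ¬ ((σ i : ℕ) < p))) ∧
      O * T * Oᵀ = monoMat σ c by
    obtain ⟨O, σ, c, hO, hσ, hc, hcp, hOT⟩ := H
    have hdet : O.det * O.det = 1 := by
      have := congrArg Matrix.det hO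
      rwa [Matrix.det_mul, Matrix.det_transpose, Matrix.det_one] at this
    rcases mul_self_eq_one_iff.mp hdet with h | h
    · exact ⟨O, σ, c, hO, h, hσ, hc, hcp, hOT⟩
    · let z : Fin (p + q) := ⟨0, by omega⟩
      let e : Fin (p + q) → ℝ := fun i => if i = z then -1 else 1
      have hee : ∀ i, e i * e i = 1 := by
        intro i; by_cases hi : i = z <;> simp [e, hi]
      refine ⟨Matrix.diagonal e * O, σ, fun i => e i * c i * e (σ i), ?_, ?_, hσ, ?_, ?_, ?_⟩
      · rw [Matrix.transpose_mul, Matrix.diagonal_transpose]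
        calc _ = Matrix.diagonal e * (O * Oᵀ) * Matrix.diagonal e := by
              simp only [Matrix.mul_assoc]
          _ = 1 := by rw [hO, Matrix.mul_one, Matrix.diagonal_mul_diagonal]; simp [hee]
      · rw [Matrix.det_mul, Matrix.det_diagonal, h]
        have : ∏ i, e i = -1 := by
          simp [e, Finset.prod_ite_eq']
        rw [this]; norm_num
      · intro i; simp only [hσ i, hc i]; ring
      · intro i hi
        apply hcp i
        intro h0; apply hi; simp [h0]
      · rw [Matrix.transpose_mul, Matrix.diagonal_transpose]
        calc _ = Matrix.diagonal e * (O * T * Oᵀ) * Matrix.diagonal e := by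
              simp only [Matrix.mul_assoc]
          _ = _ := by
              rw [hOT]
              ext i j
              rw [Matrix.mul_diagonal, Matrix.diagonal_mul]
              by_cases hj : j = σ i
              · simp [monoMat, hj]
              · simp [monoMat, hj]
  let E := EuclideanSpace ℝ (Fin (p + q))
  let TL : E →ₗ[ℝ] E := Matrix.toEuclideanLin T
  have hin : ∀ x y : E, inner ℝ x y = x.ofLp ⬝ᵥ y.ofLp := by
    intro x y
    rw [EuclideanSpace.inner_eq_star_dotProduct]
    simp [dotProduct_comm]
  have hTLa : ∀ x : E, (TL x).ofLp = T *ᵥ x.ofLp := by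
    intro x; rfl
  have hTL : ∀ x y, inner ℝ (TL x) y = - inner ℝ x (TL y) := by
    intro x y
    rw [hin, hin, hTLa, hTLa, Matrix.dotProduct_mulVec, ← Matrix.mulVec_transpose, hT,
      Matrix.neg_mulVec, neg_dotProduct, neg_neg]
  have hrk : Module.finrank ℝ (LinearMap.range TL) ≤ 2 * min p q := by
    rwa [Matrix.rank_eq_finrank_range_toLin T (EuclideanSpace.basisFun (Fin (p+q)) ℝ).toBasis
      (EuclideanSpace.basisFun (Fin (p+q)) ℝ).toBasis,
      ← Matrix.toEuclideanLin_eq_toLin_orthonormal] at hr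
  obtain ⟨r, u, v, t, huu, hvv, huv, ht, hu, hv, hker⟩ := skew_pairs _ TL hTL le_rfl
  have hvu : ∀ i < r, ∀ j < r, inner ℝ (v i) (u j) = (0:ℝ) := by
    intro i hi j hj; rw [real_inner_comm]; exact huv j hj i hi
  have hrm : r ≤ min p q := by
    let w : Fin r ⊕ Fin r → LinearMap.range TL :=
      Sum.elim (fun i => ⟨u i, ⟨(- t i)⁻¹ • v i, by
          rw [map_smul, hv i i.2, smul_smul, inv_mul_cancel₀ (by simpa using ht i i.2), one_smul]⟩⟩)
        (fun i => ⟨v i, ⟨(t i)⁻¹ • u i, by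
          rw [map_smul, hu i i.2, smul_smul, inv_mul_cancel₀ (ht i i.2), one_smul]⟩⟩)
    have hw : Orthonormal ℝ w := by
      rw [orthonormal_iff_ite]
      rintro (i | i) (j | j)
      · have := huu i i.2 j j.2
        simpa [w, Fin.ext_iff] using this
      · have := huv i i.2 j j.2
        simpa [w, Fin.ext_iff] using this
      · have := hvu i i.2 j j.2
        simpa [w, Fin.ext_iff] using this
      · have := hvv i i.2 j j.2
        simpa [w, Fin.ext_iff] using this
    have := hw.linearIndependent.fintype_card_le_finrank
    simp at this
    omega
  have hrp : r ≤ p := hrm.trans (min_le_left _ _)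
  have hrq : r ≤ q := hrm.trans (min_le_right _ _)
  let w : Fin (p + q) → E := fun i => if (i : ℕ) < r then u i else v (i - p)
  let s : Set (Fin (p + q)) := {i | (i : ℕ) < r ∨ (p ≤ (i : ℕ) ∧ (i : ℕ) - p < r)}
  have hws : Orthonormal ℝ (s.domRestrict w) := by
    rw [orthonormal_iff_ite]
    rintro ⟨i, hi⟩ ⟨j, hj⟩
    have hi' : (i : ℕ) < r ∨ (p ≤ (i : ℕ) ∧ (i : ℕ) - p < r) := hi
    have hj' : (j : ℕ) < r ∨ (p ≤ (j : ℕ) ∧ (j : ℕ) - p < r) := hj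
    change inner ℝ (w i) (w j) = _
    simp only [w, Subtype.mk.injEq, Fin.ext_iff]
    by_cases h1 : (i : ℕ) < r <;> by_cases h2 : (j : ℕ) < r
    · simp only [h1, h2, if_true]; exact huu _ h1 _ h2
    · simp only [h1, h2, if_true, if_false]
      rw [huv _ h1 _ (by omega), if_neg (by omega)]
    · simp only [h1, h2, if_true, if_false]
      rw [hvu _ (by omega) _ h2, if_neg (by omega)]
    · simp only [h1, h2, if_false]
      rw [hvv _ (by omega) _ (by omega)]
      congr 1
      apply propext
      omega
  obtain ⟨b, hb⟩ := hws.exists_orthonormalBasis_extension_of_card_eq (by simp [E])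
  let σ : Fin (p + q) → Fin (p + q) := fun i =>
    if h : (i : ℕ) < r then ⟨i + p, by omega⟩
    else if p ≤ (i : ℕ) ∧ (i : ℕ) - p < r then ⟨i - p, by omega⟩ else i
  let a : Fin (p + q) → ℝ := fun i =>
    if (i : ℕ) < r then t i else if p ≤ (i : ℕ) ∧ (i : ℕ) - p < r then - t (i - p) else 0
  have hσ : Function.Involutive σ := by
    intro i
    by_cases h1 : (i : ℕ) < r
    · have : σ i = ⟨i + p, by omega⟩ := by simp [σ, h1]
      rw [this]
      apply Fin.ext
      simp [σ, h1, show ¬ ((i : ℕ) + p < r) by omega]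
    · by_cases h2 : p ≤ (i : ℕ) ∧ (i : ℕ) - p < r
      · have : σ i = ⟨i - p, by omega⟩ := by simp [σ, h1, h2]
        rw [this]
        apply Fin.ext
        simp [σ, h2]
      · have : σ i = i := by simp only [σ, h1, h2, dite_false, if_false]
        rw [this, this]
  have ha : ∀ i, a (σ i) = - a i := by
    intro i
    by_cases h1 : (i : ℕ) < r
    · have : σ i = ⟨i + p, by omega⟩ := by simp [σ, h1]
      rw [this]
      simp [a, h1, show ¬ ((i : ℕ) + p < r) by omega]
    · by_cases h2 : p ≤ (i : ℕ) ∧ (i : ℕ) - p < r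
      · have : σ i = ⟨i - p, by omega⟩ := by simp [σ, h1, h2]
        rw [this]
        simp [a, h1, h2]
      · have : σ i = i := by simp only [σ, h1, h2, dite_false, if_false]
        rw [this]
        simp [a, h1, h2]
  have hTb : ∀ j, TL (b j) = a j • b (σ j) := by
    intro j
    by_cases h1 : (j : ℕ) < r
    · have e1 : σ j = ⟨j + p, by omega⟩ := by simp [σ, h1]
      rw [hb j (Or.inl h1), e1, hb _ (Or.inr (by simp [h1]))]
      have : a j = t j := by simp [a, h1]
      rw [this]
      simp only [w, h1, if_true, show ¬ ((j : ℕ) + p < r) by omega, if_false, Nat.add_sub_cancel]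
      exact hu _ h1
    · by_cases h2 : p ≤ (j : ℕ) ∧ (j : ℕ) - p < r
      · have e1 : σ j = ⟨j - p, by omega⟩ := by simp [σ, h1, h2]
        rw [hb j (Or.inr h2), e1, hb _ (Or.inl h2.2)]
        have : a j = - t (j - p) := by simp only [a, h1, h2, if_false]; simp
        rw [this]
        simp only [w, h1, h2.2, if_true, if_false]
        exact hv _ h2.2
      · have : a j = 0 := by simp only [a, h1, h2, if_false]
        rw [this, zero_smul]
        apply hker
        intro i hi
        have hne1 : (⟨i, by omega⟩ : Fin (p+q)) ≠ j := by
          intro h; apply h1; rw [← h]; exact hi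
        have hne2 : (⟨i + p, by omega⟩ : Fin (p+q)) ≠ j := by
          intro h; apply h2; rw [← h]; simp [hi]
        have k1 := hb ⟨i, by omega⟩ (Or.inl hi)
        have k2 := hb ⟨i + p, by omega⟩ (Or.inr (by simp [hi]))
        simp only [w, hi, if_true] at k1
        simp only [w, show ¬ (i + p < r) by omega, if_false, Nat.add_sub_cancel] at k2
        rw [← k1, ← k2]
        exact ⟨b.orthonormal.2 hne1, b.orthonormal.2 hne2⟩
  let O : Matrix (Fin (p + q)) (Fin (p + q)) ℝ := Matrix.of fun i j => (b i).ofLp j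
  refine ⟨O, σ, fun i => a (σ i), ?_, hσ, ?_, ?_, ?_⟩
  · ext i j
    have h1 := (orthonormal_iff_ite.mp b.orthonormal) i j
    rw [hin] at h1
    rw [Matrix.one_apply, ← h1]
    rfl
  · intro i; change a (σ (σ i)) = - a (σ i); rw [hσ i, ha i]; ring
  · intro i hi
    change a (σ i) ≠ 0 at hi
    rw [ha] at hi
    by_cases h1 : (i : ℕ) < r
    · have e1 : σ i = ⟨i + p, by omega⟩ := by simp [σ, h1]
      rw [e1]; simp; omega
    · by_cases h2 : p ≤ (i : ℕ) ∧ (i : ℕ) - p < r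
      · have e1 : σ i = ⟨i - p, by omega⟩ := by simp [σ, h1, h2]
        rw [e1]; simp; omega
      · exfalso; apply hi; simp only [a, h1, h2, if_false, neg_zero]
  · ext i j
    have h1 : (O * T * Oᵀ) i j = inner ℝ (b i) (TL (b j)) := by
      rw [hin, hTLa, Matrix.mul_assoc]
      rfl
    rw [h1, hTb, inner_smul_right, orthonormal_iff_ite.mp b.orthonormal]
    simp only [monoMat, Matrix.of_apply]
    by_cases h2 : j = σ i
    · rw [if_pos h2, h2, hσ i]; simp
    · rw [if_neg h2, if_neg]
      · simp
      · intro h; apply h2; rw [h, hσ j]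

lemma formMat_sq (p q : ℕ) : formMat p q * formMat p q = 1 := by
  rw [formMat, Matrix.diagonal_mul_diagonal]
  convert Matrix.diagonal_one
  rename_i i
  by_cases h : (i : ℕ) < p <;> simp [h]

lemma formMat_transpose (p q : ℕ) : (formMat p q)ᵀ = formMat p q := by
  rw [formMat, Matrix.diagonal_transpose]

/-- A matrix preserving the form, as an element of `O(p,q)`. -/
def mkIndef (p q : ℕ) (A : Matrix (Fin (p + q)) (Fin (p + q)) ℝ)
    (hA : Aᵀ * formMat p q * A = formMat p q) : indefO p q :=
  ⟨⟨A, formMat p q * Aᵀ * formMat p q, by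
      have h : (formMat p q * Aᵀ * formMat p q) * A = 1 := by
        rw [Matrix.mul_assoc, Matrix.mul_assoc, ← Matrix.mul_assoc Aᵀ, hA, formMat_sq]
      exact mul_eq_one_comm.mp h, by
      rw [Matrix.mul_assoc, Matrix.mul_assoc, ← Matrix.mul_assoc Aᵀ, hA, formMat_sq]⟩, hA⟩

lemma mem_SOZero_of_path (p q : ℕ) (F : ℝ → Matrix (Fin (p + q)) (Fin (p + q)) ℝ)
    (hF : ContinuousOn F (Set.Icc 0 1)) (h0 : F 0 = 1)
    (hm : ∀ s ∈ Set.Icc (0:ℝ) 1, (F s)ᵀ * formMat p q * F s = formMat p q) :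
    ∃ A ∈ SOZero p q, (A : Matrix (Fin (p + q)) (Fin (p + q)) ℝ) = F 1 := by
  let f : Set.Icc (0:ℝ) 1 → indefO p q := fun s => mkIndef p q (F s) (hm s s.2)
  have hF' : Continuous fun s : Set.Icc (0:ℝ) 1 => F s := continuousOn_iff_continuous_domRestrict.mp hF
  have hf : Continuous f := by
    apply Continuous.subtype_mk
    rw [Units.continuous_iff]
    refine ⟨hF', ?_⟩
    change Continuous fun s : Set.Icc (0:ℝ) 1 => formMat p q * (F s)ᵀ * formMat p q
    exact (continuous_const.matrix_mul hF'.matrix_transpose).matrix_mul continuous_const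
  have hpre : IsPreconnected (Set.range f) := by
    have : PreconnectedSpace (Set.Icc (0:ℝ) 1) :=
      Subtype.preconnectedSpace isPreconnected_Icc
    exact isPreconnected_range hf
  have h1 : (1 : indefO p q) ∈ Set.range f := by
    refine ⟨⟨0, by simp⟩, ?_⟩
    apply Subtype.ext
    apply Units.ext
    exact h0
  have hsub := hpre.subset_connectedComponent h1
  refine ⟨f ⟨1, by simp⟩, ?_, rfl⟩
  exact ⟨f ⟨1, by simp⟩, hsub ⟨_, rfl⟩, rfl⟩

lemma SOZero_det (p q : ℕ) (A : GL (Fin (p + q)) ℝ) (hA : A ∈ SOZero p q) :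
    (A : Matrix (Fin (p + q)) (Fin (p + q)) ℝ).det = 1 := by
  obtain ⟨B, hB, rfl⟩ := hA
  have hdet : ∀ C : indefO p q, ((C : GL (Fin (p+q)) ℝ) :
      Matrix (Fin (p + q)) (Fin (p + q)) ℝ).det = 1 ∨ ((C : GL (Fin (p+q)) ℝ) :
      Matrix (Fin (p + q)) (Fin (p + q)) ℝ).det = -1 := by
    intro C
    have h1 : ((C : GL (Fin (p+q)) ℝ) : Matrix (Fin (p + q)) (Fin (p + q)) ℝ)ᵀ * formMat p q *
      ((C : GL (Fin (p+q)) ℝ) : Matrix (Fin (p + q)) (Fin (p + q)) ℝ) = formMat p q := C.2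
    have h2 := congrArg Matrix.det h1
    have h3 := congrArg Matrix.det (formMat_sq p q)
    rw [Matrix.det_mul, Matrix.det_one] at h3
    rw [Matrix.det_mul, Matrix.det_mul, Matrix.det_transpose] at h2
    apply mul_self_eq_one_iff.mp
    have h4 : (formMat p q).det ≠ 0 := by intro h; simp [h] at h3
    apply mul_left_cancel₀ h4
    linarith
  let f : indefO p q → ℝ := fun C => ((C : GL (Fin (p+q)) ℝ) :
      Matrix (Fin (p + q)) (Fin (p + q)) ℝ).det
  have hf : Continuous f := (Units.continuous_val.comp continuous_subtype_val).matrix_det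
  have hpc : IsPreconnected (f '' connectedComponent 1) :=
    isPreconnected_connectedComponent.image f hf.continuousOn
  rcases hdet B with h | h
  · exact h
  · exfalso
    have hm1 : (-1 : ℝ) ∈ f '' connectedComponent 1 := ⟨B, hB, h⟩
    have hm2 : (1 : ℝ) ∈ f '' connectedComponent 1 := ⟨1, mem_connectedComponent, by simp [f]⟩
    have h0 : (0 : ℝ) ∈ f '' connectedComponent 1 :=
      hpc.ordConnected.out hm1 hm2 ⟨by norm_num, by norm_num⟩
    obtain ⟨C, _, hC⟩ := h0
    rcases hdet C with h' | h' <;> simp only [f] at hC <;> rw [hC] at h' <;> norm_num at h'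

lemma monoMat_mul {n : ℕ} (σ : Fin n → Fin n) (hσ : Function.Involutive σ) (c c' : Fin n → ℝ) :
    monoMat σ c * monoMat σ c' = Matrix.diagonal fun i => c i * c' (σ i) := by
  ext i j
  rw [Matrix.mul_apply, Matrix.diagonal_apply]
  simp only [monoMat, Matrix.of_apply, ite_mul, zero_mul, Finset.sum_ite_eq',
    Finset.mem_univ, if_true]
  rw [hσ i]
  by_cases h : i = j
  · simp [h]
  · simp [h, Ne.symm h]

lemma monoMat_transpose {n : ℕ} (σ : Fin n → Fin n) (hσ : Function.Involutive σ) (c : Fin n → ℝ) :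
    (monoMat σ c)ᵀ = monoMat σ (fun i => c (σ i)) := by
  ext i j
  simp only [monoMat, Matrix.of_apply, Matrix.transpose_apply]
  by_cases h : j = σ i
  · rw [h, hσ i]; simp
  · rw [if_neg h, if_neg]
    intro h'; apply h; rw [h', hσ j]

/-- The sign vector of the form. -/
def jv (p : ℕ) {n : ℕ} (i : Fin n) : ℝ := if (i : ℕ) < p then 1 else -1

lemma hyp_mem (p q : ℕ) (σ : Fin (p + q) → Fin (p + q)) (c : Fin (p + q) → ℝ)
    (hσ : Function.Involutive σ) (hc : ∀ i, c (σ i) = - c i)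
    (hcp : ∀ i, c i ≠ 0 → (((i : ℕ) < p) ↔ ¬ ((σ i : ℕ) < p)))
    (hc1 : ∀ i, c i ^ 2 < 1) :
    ∃ A ∈ SOZero p q, (A : Matrix (Fin (p + q)) (Fin (p + q)) ℝ) =
      (1 + monoMat σ (fun i => - jv p i * c i)) *
        Matrix.diagonal (fun i => (√(1 - c i ^ 2))⁻¹) := by
  let F : ℝ → Matrix (Fin (p + q)) (Fin (p + q)) ℝ := fun s =>
    (1 + monoMat σ (fun i => - jv p i * (s * c i))) *
        Matrix.diagonal (fun i => (√(1 - (s * c i) ^ 2))⁻¹)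
  have hlt : ∀ s ∈ Set.Icc (0:ℝ) 1, ∀ i, (s * c i) ^ 2 < 1 := by
    intro s hs i
    have := hc1 i
    have h2 : s ^ 2 ≤ 1 := by nlinarith [hs.1, hs.2]
    rw [mul_pow]
    nlinarith [sq_nonneg (c i), sq_nonneg s]
  suffices H : ∃ A ∈ SOZero p q, (A : Matrix (Fin (p + q)) (Fin (p + q)) ℝ) = F 1 by
    obtain ⟨A, hA, hA1⟩ := H
    refine ⟨A, hA, ?_⟩
    rw [hA1]; simp [F]
  refine mem_SOZero_of_path p q F ?_ ?_ ?_
  · apply ContinuousOn.mul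
    · apply Continuous.continuousOn
      refine continuous_const.add ?_
      refine continuous_matrix fun i j => ?_
      simp only [monoMat, Matrix.of_apply]
      split_ifs
      · fun_prop
      · fun_prop
    · apply continuousOn_pi.mpr; intro i
      apply continuousOn_pi.mpr; intro j
      simp only [Matrix.diagonal_apply]
      split_ifs
      · apply ContinuousOn.inv₀
        · apply Continuous.continuousOn; fun_prop
        · intro s hs
          have := hlt s hs i
          apply (Real.sqrt_pos.mpr _).ne'
          linarith
      · exact continuousOn_const
  · simp only [F]
    have : monoMat σ (fun i => - jv p i * (0 * c i)) = 0 := by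
      ext i j; simp [monoMat]
    rw [this]; simp
  · intro s hs
    have hl := hlt s hs
    set e : Fin (p + q) → ℝ := fun i => - jv p i * (s * c i) with he
    have heσ : ∀ i, e (σ i) = e i := by
      intro i
      by_cases h : c i = 0
      · simp [he, hc, h]
      · have := hcp i h
        simp only [he, hc, jv]
        by_cases hi : (i : ℕ) < p
        · simp [hi, this.mp hi]
        · have : (σ i : ℕ) < p := by by_contra h'; exact hi (this.mpr h')
          simp [hi, this]
    have het : (monoMat σ e)ᵀ = monoMat σ e := by
      rw [monoMat_transpose σ hσ]; simp only [heσ]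
    have hanti : monoMat σ e * formMat p q = - (formMat p q * monoMat σ e) := by
      ext i j
      rw [formMat, Matrix.mul_diagonal, Matrix.neg_apply, Matrix.diagonal_mul]
      simp only [monoMat, Matrix.of_apply]
      by_cases h : j = σ i
      · rw [if_pos h, h]
        by_cases h' : c i = 0
        · simp [he, h']
        · have := hcp i h'
          by_cases hi : (i : ℕ) < p
          · simp [hi, this.mp hi]
          · have : (σ i : ℕ) < p := by by_contra h'; exact hi (this.mpr h')
            simp [hi, this]
      · simp [h]
    have hsq : monoMat σ e * monoMat σ e = Matrix.diagonal fun i => (s * c i) ^ 2 := by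
      rw [monoMat_mul σ hσ]
      congr 1
      ext i
      rw [heσ]
      simp only [he, jv]
      by_cases hi : (i : ℕ) < p <;> simp [hi] <;> ring
    change ((1 + monoMat σ e) * Matrix.diagonal (fun i => (√(1 - (s * c i) ^ 2))⁻¹))ᵀ *
      formMat p q * ((1 + monoMat σ e) * Matrix.diagonal (fun i => (√(1 - (s * c i) ^ 2))⁻¹)) = _
    rw [Matrix.transpose_mul, Matrix.diagonal_transpose, Matrix.transpose_add,
      Matrix.transpose_one, het]
    have key : (1 + monoMat σ e) * formMat p q * (1 + monoMat σ e) =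
        formMat p q * Matrix.diagonal fun i => 1 - (s * c i) ^ 2 := by
      have : (Matrix.diagonal fun i => 1 - (s * c i) ^ 2) = 1 - monoMat σ e * monoMat σ e := by
        rw [hsq, ← Matrix.diagonal_one, Matrix.diagonal_sub]
      rw [this, Matrix.add_mul, hanti]
      noncomm_ring
    calc _ = Matrix.diagonal (fun i => (√(1 - (s * c i) ^ 2))⁻¹) *
          ((1 + monoMat σ e) * formMat p q * (1 + monoMat σ e)) *
          Matrix.diagonal (fun i => (√(1 - (s * c i) ^ 2))⁻¹) := by
          simp only [Matrix.mul_assoc]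
      _ = _ := by
          rw [key, formMat]
          simp only [Matrix.diagonal_mul_diagonal]
          congr 1
          ext i
          have h1 : 0 < 1 - (s * c i) ^ 2 := by linarith [hl i]
          have h2 : √(1 - (s * c i) ^ 2) ≠ 0 := (Real.sqrt_pos.mpr h1).ne'
          have h3 := Real.mul_self_sqrt h1.le
          generalize √(1 - (s * c i) ^ 2) = x at h2 h3
          rw [← h3]
          field_simp

/-- Complexification of a real matrix. -/
def cmat {n : ℕ} (M : Matrix (Fin n) (Fin n) ℝ) : Matrix (Fin n) (Fin n) ℂ :=
  M.map (fun x : ℝ => (x : ℂ))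

lemma cmat_mul {n : ℕ} (M N : Matrix (Fin n) (Fin n) ℝ) : cmat (M * N) = cmat M * cmat N := by
  ext i j; simp [cmat, Matrix.mul_apply]

lemma cmat_add {n : ℕ} (M N : Matrix (Fin n) (Fin n) ℝ) : cmat (M + N) = cmat M + cmat N := by
  ext i j; simp [cmat]

lemma cmat_sub {n : ℕ} (M N : Matrix (Fin n) (Fin n) ℝ) : cmat (M - N) = cmat M - cmat N := by
  ext i j; simp [cmat]

lemma cmat_one {n : ℕ} : cmat (1 : Matrix (Fin n) (Fin n) ℝ) = 1 := by
  ext i j; by_cases h : i = j <;> simp [cmat, Matrix.one_apply, h]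

lemma cmat_transpose {n : ℕ} (M : Matrix (Fin n) (Fin n) ℝ) : cmat Mᵀ = (cmat M)ᵀ := by
  ext i j; simp [cmat]

lemma cmat_det {n : ℕ} (M : Matrix (Fin n) (Fin n) ℝ) : (cmat M).det = (M.det : ℂ) := by
  have := (RingHom.map_det Complex.ofRealHom M)
  exact this.symm

lemma cmat_sep {n : ℕ} (X Y : Matrix (Fin n) (Fin n) ℝ)
    (h : cmat X + Complex.I • cmat Y = 1) : X = 1 ∧ Y = 0 := by
  constructor
  · ext i j
    have := congrArg Complex.re (congrFun (congrFun h i) j)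
    by_cases hij : i = j <;> simpa [cmat, Matrix.one_apply, hij] using this
  · ext i j
    have := congrArg Complex.im (congrFun (congrFun h i) j)
    by_cases hij : i = j <;> simpa [cmat, Matrix.one_apply, hij] using this

/-- An element of `SO(n,ℂ)` from a matrix. -/
def mkSOC {n : ℕ} (A : Matrix (Fin n) (Fin n) ℂ) (h1 : Aᵀ * A = 1) (h2 : A.det = 1) : SOC n :=
  ⟨⟨A, Aᵀ, mul_eq_one_comm.mp h1, h1⟩, h1, h2⟩

/-- The underlying matrix. -/
def mat {n : ℕ} (g : SOC n) : Matrix (Fin n) (Fin n) ℂ := ((g : GL (Fin n) ℂ) : Matrix _ _ ℂ)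

lemma mat_mul {n : ℕ} (g h : SOC n) : mat (g * h) = mat g * mat h := rfl

lemma mat_inj {n : ℕ} {g h : SOC n} (hh : mat g = mat h) : g = h :=
  Subtype.ext (Units.ext hh)

lemma mat_tm {n : ℕ} (g : SOC n) : (mat g)ᵀ * mat g = 1 := g.2.1

lemma mat_mt {n : ℕ} (g : SOC n) : mat g * (mat g)ᵀ = 1 := mul_eq_one_comm.mp g.2.1

lemma mat_det {n : ℕ} (g : SOC n) : (mat g).det = 1 := g.2.2

/-- The subgroup `H`. -/
abbrev Hsub (p q : ℕ) : Subgroup (SOC (p + q)) :=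
  (Subgroup.map (Units.map (embedDconj p q)) (SOZero p q)).subgroupOf (SOC (p + q))

lemma embed_apply (p q : ℕ) (A : Matrix (Fin (p + q)) (Fin (p + q)) ℝ) (i j : Fin (p + q)) :
    embedDconj p q A i j = (if (i : ℕ) < p then (1 : ℂ) else Complex.I) * (A i j : ℂ) *
      (if (j : ℕ) < p then (1 : ℂ) else -Complex.I) := by
  change ((Matrix.diagonal fun i : Fin (p+q) => if (i : ℕ) < p then (1 : ℂ) else Complex.I) *
    cmat A * (Matrix.diagonal fun i : Fin (p+q) => if (i : ℕ) < p then (1 : ℂ) else -Complex.I))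
    i j = _
  rw [Matrix.mul_diagonal, Matrix.diagonal_mul]
  rfl

lemma embed_det (p q : ℕ) (A : Matrix (Fin (p + q)) (Fin (p + q)) ℝ) :
    (embedDconj p q A).det = (A.det : ℂ) := by
  change (((Dunit p q : (Matrix _ _ ℂ)ˣ) : Matrix _ _ ℂ) * cmat A *
    (((Dunit p q)⁻¹ : (Matrix _ _ ℂ)ˣ) : Matrix _ _ ℂ)).det = _
  rw [Matrix.det_units_conj, cmat_det]

lemma embed_tm (p q : ℕ) (A : Matrix (Fin (p + q)) (Fin (p + q)) ℝ)
    (hA : Aᵀ * formMat p q * A = formMat p q) :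
    (embedDconj p q A)ᵀ * embedDconj p q A = 1 := by
  ext i j
  have h := congrFun (congrFun hA i) j
  rw [formMat, Matrix.mul_apply] at h
  simp only [Matrix.mul_diagonal, Matrix.transpose_apply] at h
  have h' := congrArg (fun x : ℝ => (x : ℂ)) h
  simp only [Complex.ofReal_sum, Complex.ofReal_mul] at h'
  rw [Matrix.mul_apply]
  simp only [Matrix.transpose_apply, embed_apply]
  calc _ = (if (i : ℕ) < p then (1 : ℂ) else -Complex.I) *
        (if (j : ℕ) < p then (1 : ℂ) else -Complex.I) *
        ∑ k : Fin (p+q), (A k i : ℂ) * ((if (k : ℕ) < p then (1:ℝ) else -1 : ℝ) : ℂ) * (A k j : ℂ) := by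
        rw [Finset.mul_sum]
        apply Finset.sum_congr rfl
        intro k _
        have : (if (k : ℕ) < p then (1 : ℂ) else Complex.I) *
          (if (k : ℕ) < p then (1 : ℂ) else Complex.I) =
          ((if (k : ℕ) < p then (1:ℝ) else -1 : ℝ) : ℂ) := by
          by_cases hk : (k : ℕ) < p <;> simp [hk]
        rw [← this]; ring
    _ = _ := by
        rw [h', Matrix.diagonal_apply, Matrix.one_apply]
        by_cases hij : i = j
        · subst hij
          by_cases hi : (i : ℕ) < p <;> simp [hi]
        · simp [hij]

lemma orth_entry {n : ℕ} (k : Matrix (Fin n) (Fin n) ℝ) (hk : k * kᵀ = 1) (i j : Fin n) :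
    |k i j| ≤ 1 := by
  have h := congrFun (congrFun hk i) i
  rw [Matrix.mul_apply, Matrix.one_apply_eq] at h
  simp only [Matrix.transpose_apply] at h
  have h2 : k i j * k i j ≤ ∑ l, k i l * k i l :=
    Finset.single_le_sum (f := fun l => k i l * k i l) (fun l _ => mul_self_nonneg _)
      (Finset.mem_univ j)
  rw [h] at h2
  rw [← sq, ← sq_abs] at h2
  have := abs_nonneg (k i j)
  nlinarith

lemma decomp (p q : ℕ) (hp : 0 < p) (g : SOC (p + q))
    (hr : ((mat g).map Complex.im).rank ≤ 2 * min p q) :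
    ∃ k1 h k2 : SOC (p + q), (∀ i j, ‖mat k1 i j‖ ≤ 1) ∧ (∀ i j, ‖mat k2 i j‖ ≤ 1) ∧
      h ∈ Hsub p q ∧ g = k1 * h * k2 := by
  set R : Matrix (Fin (p + q)) (Fin (p + q)) ℝ := (mat g).map Complex.re with hRdef
  set S : Matrix (Fin (p + q)) (Fin (p + q)) ℝ := (mat g).map Complex.im with hSdef
  have hg : mat g = cmat R + Complex.I • cmat S := by
    ext i j
    simp only [cmat, R, S, Matrix.add_apply, Matrix.smul_apply, Matrix.map_apply, smul_eq_mul]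
    rw [mul_comm]; exact (Complex.re_add_im _).symm
  have hprod : ∀ X Y X' Y' : Matrix (Fin (p + q)) (Fin (p + q)) ℝ,
      (cmat X + Complex.I • cmat Y) * (cmat X' + Complex.I • cmat Y') =
      cmat (X * X' - Y * Y') + Complex.I • cmat (X * Y' + Y * X') := by
    intro X Y X' Y'
    rw [cmat_sub, cmat_add, cmat_mul, cmat_mul, cmat_mul, cmat_mul, Matrix.add_mul,
      Matrix.mul_add, Matrix.mul_add]
    simp only [Matrix.smul_mul, Matrix.mul_smul, smul_smul, Complex.I_mul_I, smul_add, neg_smul,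
      one_smul]
    abel
  have ht : (mat g)ᵀ = cmat Rᵀ + Complex.I • cmat Sᵀ := by
    rw [hg, Matrix.transpose_add, Matrix.transpose_smul, cmat_transpose, cmat_transpose]
  have e1 := mat_tm g
  rw [ht, hg, hprod] at e1
  obtain ⟨e1, e2⟩ := cmat_sep _ _ e1
  have e3 := mat_mt g
  rw [ht, hg, hprod] at e3
  obtain ⟨e3, e4⟩ := cmat_sep _ _ e3
  have hRu : IsUnit R.det := by
    have h1 : Rᵀ * R = 1 + Sᴴ * S := by
      rw [Matrix.conjTranspose_eq_transpose_of_trivial, ← e1]; abel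
    have h2 : (Rᵀ * R).PosDef := by
      rw [h1]
      exact Matrix.PosDef.one.add_posSemidef (Matrix.posSemidef_conjTranspose_mul_self S)
    have h3 := h2.det_pos
    rw [Matrix.det_mul, Matrix.det_transpose] at h3
    rw [isUnit_iff_ne_zero]
    intro h; simp [h] at h3
  obtain ⟨T, hTdef⟩ : ∃ T, T = S * R⁻¹ := ⟨_, rfl⟩
  have hSTR : S = T * R := by
    rw [hTdef, Matrix.mul_assoc, Matrix.nonsing_inv_mul R hRu, Matrix.mul_one]
  have hTskew : Tᵀ = -T := by
    have h1 : Rᵀ * (T + Tᵀ) * R = 0 := by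
      have hSt : Sᵀ = Rᵀ * Tᵀ := by rw [hSTR, Matrix.transpose_mul]
      calc Rᵀ * (T + Tᵀ) * R = Rᵀ * (T * R) + (Rᵀ * Tᵀ) * R := by noncomm_ring
        _ = Rᵀ * S + Sᵀ * R := by rw [← hSTR, ← hSt]
        _ = 0 := e2
    have hRi : R * R⁻¹ = 1 := Matrix.mul_nonsing_inv R hRu
    have hRi' : (R⁻¹)ᵀ * Rᵀ = 1 := by rw [← Matrix.transpose_mul, hRi, Matrix.transpose_one]
    have h2 : T + Tᵀ = (R⁻¹)ᵀ * (Rᵀ * (T + Tᵀ) * R) * R⁻¹ := by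
      calc T + Tᵀ = ((R⁻¹)ᵀ * Rᵀ) * (T + Tᵀ) * (R * R⁻¹) := by rw [hRi, hRi']; simp
        _ = _ := by simp only [Matrix.mul_assoc]
    rw [h1] at h2
    simp only [Matrix.mul_zero, Matrix.zero_mul] at h2
    exact eq_neg_of_add_eq_zero_right h2
  have hTr : T.rank ≤ 2 * min p q := by
    rw [hTdef]; exact (Matrix.rank_mul_le_left _ _).trans hr
  obtain ⟨O, σ, c, hO, hOdet, hσ, hc, hcp, hOT⟩ := skew_normal_matrix p q hp T hTskew hTr
  have hO' : Oᵀ * O = 1 := mul_eq_one_comm.mp hO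
  set N := monoMat σ c with hN
  have hNt : Nᵀ = -N := by
    rw [hN, monoMat_transpose σ hσ]
    ext i j; simp only [monoMat, Matrix.of_apply, hc, Matrix.neg_apply]
    split_ifs <;> simp
  set Q := O * R with hQ
  set W := Q * Qᵀ with hW
  have hOS : O * S = N * Q := by
    calc O * S = O * (T * R) := by rw [← hSTR]
      _ = O * T * (Oᵀ * O) * R := by rw [hO', Matrix.mul_one, Matrix.mul_assoc]
      _ = (O * T * Oᵀ) * (O * R) := by simp only [Matrix.mul_assoc]
      _ = N * Q := by rw [hOT]
  have w1 : W - N * W * Nᵀ = 1 := by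
    have : W - N * W * Nᵀ = O * (R * Rᵀ - S * Sᵀ) * Oᵀ := by
      have h1 : N * W * Nᵀ = (N * Q) * (N * Q)ᵀ := by
        rw [Matrix.transpose_mul, hW]; simp only [Matrix.mul_assoc]
      rw [h1, ← hOS, hW, hQ, Matrix.transpose_mul, Matrix.transpose_mul]
      noncomm_ring
    rw [this, e3, Matrix.mul_one, hO]
  have w2 : W * Nᵀ + N * W = 0 := by
    have h1 : W * Nᵀ + N * W = Q * (N * Q)ᵀ + (N * Q) * Qᵀ := by
      rw [Matrix.transpose_mul, hW]; simp only [Matrix.mul_assoc]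
    have h2 : Q * (N * Q)ᵀ + (N * Q) * Qᵀ = O * (R * Sᵀ + S * Rᵀ) * Oᵀ := by
      rw [← hOS, hQ, Matrix.transpose_mul, Matrix.transpose_mul]; noncomm_ring
    rw [h1, h2, e4]; simp
  have hNN : N * N = Matrix.diagonal fun i => - c i ^ 2 := by
    rw [hN, monoMat_mul σ hσ]
    congr 1; ext i; rw [hc]; ring
  have w3 : W * Matrix.diagonal (fun i => 1 - c i ^ 2) = 1 := by
    have hNW : N * W = W * N := by
      rw [hNt] at w2
      have := eq_neg_of_add_eq_zero_right w2
      rw [this]; simp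
    have : Matrix.diagonal (fun i => 1 - c i ^ 2) = 1 + N * N := by
      rw [hNN, ← Matrix.diagonal_one, Matrix.diagonal_add]
      congr 1
    rw [this]
    calc W * (1 + N * N) = W + (W * N) * N := by noncomm_ring
      _ = W - N * W * Nᵀ := by rw [hNt, ← hNW]; noncomm_ring
      _ = 1 := w1
  have hpos : ∀ i, 0 < 1 - c i ^ 2 := by
    intro i
    have h1 := congrFun (congrFun w3 i) i
    rw [Matrix.mul_diagonal, Matrix.one_apply_eq] at h1
    have h2 : 0 ≤ W i i := by
      rw [hW, Matrix.mul_apply]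
      exact Finset.sum_nonneg fun l _ => by
        rw [Matrix.transpose_apply]; exact mul_self_nonneg _
    by_contra h3
    push Not at h3
    nlinarith
  have hsq : ∀ i, √(1 - c i ^ 2) ≠ 0 := fun i => (Real.sqrt_pos.mpr (hpos i)).ne'
  have hdd : Matrix.diagonal (fun i => (√(1 - c i ^ 2))⁻¹) *
      Matrix.diagonal (fun i => √(1 - c i ^ 2)) = 1 := by
    rw [Matrix.diagonal_mul_diagonal, ← Matrix.diagonal_one]
    congr 1; ext i; exact inv_mul_cancel₀ (hsq i)
  set k := Matrix.diagonal (fun i => √(1 - c i ^ 2)) * Q with hk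
  have hkQ : Q = Matrix.diagonal (fun i => (√(1 - c i ^ 2))⁻¹) * k := by
    rw [hk, ← Matrix.mul_assoc, hdd, Matrix.one_mul]
  have hkk : k * kᵀ = 1 := by
    have h1 : k * kᵀ = Matrix.diagonal (fun i => √(1 - c i ^ 2)) * (W *
        (Matrix.diagonal (fun i => 1 - c i ^ 2)) *
        Matrix.diagonal (fun i => (√(1 - c i ^ 2))⁻¹)) := by
      rw [hk, Matrix.transpose_mul, Matrix.diagonal_transpose, hW]
      have : Matrix.diagonal (fun i => √(1 - c i ^ 2)) =
        Matrix.diagonal (fun i => 1 - c i ^ 2) * Matrix.diagonal (fun i => (√(1 - c i ^ 2))⁻¹) := by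
        rw [Matrix.diagonal_mul_diagonal]
        congr 1; ext i
        have h3 := Real.mul_self_sqrt (hpos i).le
        rw [eq_mul_inv_iff_mul_eq₀ (hsq i), h3]
      conv_lhs => rw [this]
      conv_rhs => rw [this]
      simp only [Matrix.mul_assoc]
    rw [h1, w3, Matrix.one_mul]
    exact mul_eq_one_comm.mp hdd
  obtain ⟨A, hA, hAm⟩ := hyp_mem p q σ c hσ hc hcp (fun i => by linarith [hpos i])
  have hAO : (A : Matrix (Fin (p + q)) (Fin (p + q)) ℝ)ᵀ * formMat p q * A = formMat p q := by
    obtain ⟨B, _, rfl⟩ := hA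
    exact B.2
  let h : SOC (p + q) := mkSOC (embedDconj p q A) (embed_tm p q _ hAO)
    (by rw [embed_det, SOZero_det p q A hA]; simp)
  have hhm : mat h = (1 + Complex.I • cmat N) *
      cmat (Matrix.diagonal (fun i => (√(1 - c i ^ 2))⁻¹)) := by
    change embedDconj p q A = _
    ext i j
    have hd : cmat (Matrix.diagonal (fun i => (√(1 - c i ^ 2))⁻¹)) =
        Matrix.diagonal (fun i => (((√(1 - c i ^ 2))⁻¹ : ℝ) : ℂ)) := by
      ext a b; by_cases hab : a = b <;> simp [cmat, hab]
    rw [embed_apply, hAm, hd, Matrix.mul_diagonal, Matrix.mul_diagonal]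
    simp only [Matrix.add_apply, Matrix.smul_apply, smul_eq_mul, cmat, Matrix.map_apply, hN,
      monoMat, Matrix.of_apply, Matrix.one_apply, Complex.ofReal_mul, Complex.ofReal_add]
    have key : (if (i : ℕ) < p then (1 : ℂ) else Complex.I) *
        (((if i = j then (1:ℝ) else 0 : ℝ) : ℂ) + ((if j = σ i then - jv p i * c i else 0 : ℝ) : ℂ)) *
        (if (j : ℕ) < p then (1 : ℂ) else -Complex.I) = (if i = j then (1:ℂ) else 0) +
        Complex.I * ((if j = σ i then c i else 0 : ℝ) : ℂ) := by
      have k1 : (if (i : ℕ) < p then (1 : ℂ) else Complex.I) *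
        ((if i = j then (1:ℝ) else 0 : ℝ) : ℂ) *
        (if (j : ℕ) < p then (1 : ℂ) else -Complex.I) = (if i = j then (1:ℂ) else 0) := by
        by_cases hij : i = j
        · subst hij
          by_cases hi : (i : ℕ) < p <;> simp [hi]
        · simp [hij]
      have k2 : (if (i : ℕ) < p then (1 : ℂ) else Complex.I) *
        ((if j = σ i then - jv p i * c i else 0 : ℝ) : ℂ) *
        (if (j : ℕ) < p then (1 : ℂ) else -Complex.I) =
        Complex.I * ((if j = σ i then c i else 0 : ℝ) : ℂ) := by
        by_cases hij : j = σ i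
        · by_cases h0 : c i = 0
          · simp [h0]
          · have hh := hcp i h0
            rw [hij]
            by_cases hi : (i : ℕ) < p
            · have h2 := hh.mp hi
              simp [hi, h2, jv, mul_comm]
            · have h2 : (σ i : ℕ) < p := by by_contra h'; exact hi (hh.mpr h')
              simp [hi, h2, jv]
        · simp [hij]
      rw [mul_add, add_mul, k1, k2]
    rw [← key]; ring
  have hcO : cmat Oᵀ * cmat O = 1 := by rw [← cmat_mul, hO', cmat_one]
  have hgm : mat g = cmat Oᵀ * mat h * cmat k := by
    rw [hhm]
    have h1 : cmat O * mat g = (1 + Complex.I • cmat N) *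
        cmat (Matrix.diagonal (fun i => (√(1 - c i ^ 2))⁻¹)) * cmat k := by
      rw [Matrix.mul_assoc, ← cmat_mul, ← hkQ, hg, Matrix.mul_add, Matrix.mul_smul, ← cmat_mul,
        ← cmat_mul, ← hQ, hOS, Matrix.add_mul, Matrix.one_mul, Matrix.smul_mul, ← cmat_mul]
    calc mat g = cmat Oᵀ * (cmat O * mat g) := by rw [← Matrix.mul_assoc, hcO, Matrix.one_mul]
      _ = _ := by rw [h1]; simp only [Matrix.mul_assoc]
  have hkdet : (cmat k).det = 1 := by
    have h1 := congrArg Matrix.det hgm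
    rw [Matrix.det_mul, Matrix.det_mul, mat_det, mat_det, cmat_det, Matrix.det_transpose,
      hOdet] at h1
    simpa using h1.symm
  refine ⟨mkSOC (cmat Oᵀ) ?_ ?_, h, mkSOC (cmat k) ?_ hkdet, ?_, ?_, ?_, ?_⟩
  · rw [← cmat_transpose, ← cmat_mul, Matrix.transpose_transpose, hO, cmat_one]
  · rw [cmat_det, Matrix.det_transpose, hOdet]; simp
  · rw [← cmat_transpose, ← cmat_mul, mul_eq_one_comm.mp hkk, cmat_one]
  · intro i j
    change ‖((O j i : ℝ) : ℂ)‖ ≤ 1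
    rw [Complex.norm_real]
    exact orth_entry O hO j i
  · intro i j
    change ‖((k i j : ℝ) : ℂ)‖ ≤ 1
    rw [Complex.norm_real]
    exact orth_entry k hkk i j
  · exact ⟨A, hA, Units.ext rfl⟩
  · apply mat_inj
    rw [mat_mul, mat_mul]
    exact hgm

/-- Elements of `SO(n,ℂ)` with entries bounded by `R`. -/
def KR (n : ℕ) (R : ℝ) : Set (SOC n) := {g | ∀ i j, ‖mat g i j‖ ≤ R}

lemma continuous_mat {n : ℕ} : Continuous (mat : SOC n → Matrix (Fin n) (Fin n) ℂ) :=
  Units.continuous_val.comp continuous_subtype_val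

lemma KR_compact (n : ℕ) (R : ℝ) : IsCompact (KR n R) := by
  let Z : Set (Matrix (Fin n) (Fin n) ℂ) := {A | (Aᵀ * A = 1 ∧ A.det = 1) ∧ ∀ i j, ‖A i j‖ ≤ R}
  have hZ : IsCompact Z := by
    have h1 : IsCompact (Set.univ.pi fun _ : Fin n => Set.univ.pi fun _ : Fin n =>
        Metric.closedBall (0 : ℂ) R) :=
      isCompact_univ_pi fun _ => isCompact_univ_pi fun _ => isCompact_closedBall _ _
    have h2 : IsClosed {A : Matrix (Fin n) (Fin n) ℂ | Aᵀ * A = 1 ∧ A.det = 1} := by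
      apply IsClosed.inter
      · exact isClosed_eq (by fun_prop) continuous_const
      · exact isClosed_eq (by fun_prop) continuous_const
    have h3 := h1.inter_left h2
    have hZe : Z = {A : Matrix (Fin n) (Fin n) ℂ | Aᵀ * A = 1 ∧ A.det = 1} ∩
        (Set.univ.pi fun _ : Fin n => Set.univ.pi fun _ : Fin n => Metric.closedBall (0 : ℂ) R) := by
      ext A
      constructor
      · rintro ⟨h1, h2⟩
        exact ⟨h1, fun i _ j _ => mem_closedBall_zero_iff.mpr (h2 i j)⟩
      · rintro ⟨h1, h2⟩
        exact ⟨h1, fun i j => mem_closedBall_zero_iff.mp (h2 i trivial j trivial)⟩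
    rw [hZe]
    exact h3
  have : CompactSpace Z := isCompact_iff_compactSpace.mp hZ
  let f : Z → SOC n := fun A => mkSOC A.1 A.2.1.1 A.2.1.2
  have hf : Continuous f := by
    apply Continuous.subtype_mk
    rw [Units.continuous_iff]
    constructor
    · exact continuous_subtype_val
    · change Continuous fun A : Z => (A.1)ᵀ
      exact continuous_subtype_val.matrix_transpose
  have : KR n R = Set.range f := by
    ext g
    constructor
    · intro hg
      exact ⟨⟨mat g, ⟨mat_tm g, mat_det g⟩, hg⟩, mat_inj rfl⟩
    · rintro ⟨A, rfl⟩
      exact A.2.2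
  rw [this]
  exact isCompact_range hf

lemma cocompact_cover {G : Type*} [Group G] [TopologicalSpace G] [IsTopologicalGroup G]
    (H Γ : Subgroup G) (hc : CompactSpace (Quotient (MulAction.orbitRel Γ (G ⧸ H))))
    (U : ℕ → Set G) (hU : ∀ k, IsOpen (U k)) (hmono : Monotone U) (hcov : ∀ g, ∃ k, g ∈ U k) :
    ∃ k, ∀ g, ∃ γ ∈ Γ, ∃ c ∈ U k, ∃ h ∈ H, g = γ * c * h := by
  let f : G → Quotient (MulAction.orbitRel Γ (G ⧸ H)) := fun g => Quotient.mk _ (g : G ⧸ H)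
  have hf : IsOpenMap f := by
    have : ContinuousConstSMul Γ (G ⧸ H) :=
      ⟨fun γ => continuous_const_smul (γ : G)⟩
    have h1 : IsOpenMap (fun g : G => (g : G ⧸ H)) := QuotientGroup.isOpenMap_coe
    have h2 : IsOpenMap (Quotient.mk (MulAction.orbitRel Γ (G ⧸ H))) :=
      isOpenMap_quotient_mk'_mul
    exact h2.comp h1
  obtain ⟨k, hk⟩ := isCompact_univ.elim_directed_cover (fun k => f '' U k) (fun k => hf _ (hU k))
    (by
      intro x _
      induction x using Quotient.inductionOn with
      | h x =>
        induction x using QuotientGroup.induction_on with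
        | H g =>
          obtain ⟨k, hk⟩ := hcov g
          exact Set.mem_iUnion.mpr ⟨k, g, hk, rfl⟩)
    (directed_of_isDirected_le fun i j hij => Set.image_mono (hmono hij))
  refine ⟨k, fun g => ?_⟩
  obtain ⟨c, hcU, hcg⟩ := hk (Set.mem_univ (f g))
  have h1 : (MulAction.orbitRel Γ (G ⧸ H)) (g : G ⧸ H) (c : G ⧸ H) := Quotient.exact hcg.symm
  rw [MulAction.orbitRel_apply] at h1
  obtain ⟨γ, hγ⟩ := h1
  have h2 : (((γ : G) * c : G) : G ⧸ H) = (g : G ⧸ H) := hγ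
  rw [QuotientGroup.eq] at h2
  exact ⟨γ, γ.2, c, hcU, _, h2, by group⟩

lemma rank_add_le_aux {n : ℕ} (M N : Matrix (Fin n) (Fin n) ℝ) :
    (M + N).rank ≤ M.rank + N.rank := by
  simp only [Matrix.rank]
  refine le_trans (Submodule.finrank_mono ?_)
    (Submodule.finrank_add_le_finrank_add_finrank (LinearMap.range M.mulVecLin)
      (LinearMap.range N.mulVecLin))
  rintro _ ⟨x, rfl⟩
  rw [Matrix.mulVecLin_add]
  exact Submodule.add_mem_sup ⟨x, rfl⟩ ⟨x, rfl⟩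

lemma rank_block {n : ℕ} (M : Matrix (Fin n) (Fin n) ℝ) (P : Fin n → Prop) [DecidablePred P]
    (hM : ∀ i j, P i → P j → M i j = 0) : M.rank ≤ 2 * Fintype.card {i // ¬ P i} := by
  let w : Fin n → ℝ := fun i => if P i then 0 else 1
  have hD : (Matrix.diagonal w).rank = Fintype.card {i // ¬ P i} := by
    rw [Matrix.rank_diagonal]
    apply Fintype.card_congr
    apply Equiv.subtypeEquivRight
    intro i
    by_cases h : P i <;> simp [w, h]
  have hM' : M = Matrix.diagonal w * M + ((1 - Matrix.diagonal w) * M) * Matrix.diagonal w := by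
    ext i j
    rw [Matrix.sub_mul, Matrix.one_mul]
    simp only [Matrix.add_apply, Matrix.mul_diagonal, Matrix.diagonal_mul, Matrix.sub_apply, w]
    by_cases hi : P i <;> by_cases hj : P j <;> simp [hi, hj]
    exact hM i j hi hj
  calc M.rank ≤ (Matrix.diagonal w * M).rank +
        (((1 - Matrix.diagonal w) * M) * Matrix.diagonal w).rank := by
        conv_lhs => rw [hM']
        exact rank_add_le_aux _ _
    _ ≤ (Matrix.diagonal w).rank + (Matrix.diagonal w).rank :=
        add_le_add (Matrix.rank_mul_le_left _ _) (Matrix.rank_mul_le_right _ _)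
    _ = _ := by rw [hD]; ring

lemma card_lt_block (p q : ℕ) : Fintype.card {i : Fin (p + q) // (i : ℕ) < p} ≤ p := by
  have := Fintype.card_le_of_injective
    (fun i : {i : Fin (p + q) // (i : ℕ) < p} => (⟨i.1, i.2⟩ : Fin p))
    (by intro i j h; ext; simpa using h)
  simpa using this

lemma card_ge_block (p q : ℕ) : Fintype.card {i : Fin (p + q) // ¬ (i : ℕ) < p} ≤ q := by
  have := Fintype.card_le_of_injective
    (fun i : {i : Fin (p + q) // ¬ (i : ℕ) < p} => (⟨i.1 - p, by have := i.2; omega⟩ : Fin q))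
    (by
      intro i j h
      have h1 := i.2
      have h2 := j.2
      simp only [Fin.mk.injEq] at h
      ext; omega)
  simpa using this

/-- The hyperbolic one-parameter subgroup in the plane of two coordinates. -/
def sMat {n : ℕ} (a b : Fin n) (t : ℝ) : Matrix (Fin n) (Fin n) ℂ :=
  1 + ((Real.cosh t : ℂ) - 1) • (Matrix.single a a 1 + Matrix.single b b 1) +
    (Complex.I * (Real.sinh t : ℂ)) • (Matrix.single a b 1 - Matrix.single b a 1)

lemma sMat_mul {n : ℕ} (a b : Fin n) (hab : a ≠ b) (t u : ℝ) :
    sMat a b t * sMat a b u = sMat a b (t + u) := by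
  have hba := hab.symm
  set E : Matrix (Fin n) (Fin n) ℂ := Matrix.single a a 1 + Matrix.single b b 1 with hE
  set F : Matrix (Fin n) (Fin n) ℂ := Matrix.single a b 1 - Matrix.single b a 1 with hF
  have hEE : E * E = E := by
    simp [hE, Matrix.add_mul, Matrix.mul_add, hab, hba]
  have hEF : E * F = F := by
    simp [hE, hF, Matrix.add_mul, Matrix.mul_sub, hab, hba]
  have hFE : F * E = F := by
    simp [hE, hF, Matrix.sub_mul, Matrix.mul_add, hab, hba]
    abel
  have hFF : F * F = -E := by
    simp [hE, hF, Matrix.sub_mul, Matrix.mul_sub, hab, hba]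
    abel
  simp only [sMat, ← hE, ← hF]
  clear_value E F
  simp only [Matrix.add_mul, Matrix.mul_add, Matrix.one_mul, Matrix.mul_one, Matrix.smul_mul,
    Matrix.mul_smul, hEE, hEF, hFE, hFF, Real.cosh_add, Real.sinh_add]
  push_cast
  have hI := Complex.I_mul_I
  match_scalars
  · ring
  · linear_combination (-(Complex.sinh t * Complex.sinh u)) * hI
  · ring

lemma sMat_zero {n : ℕ} (a b : Fin n) : sMat a b 0 = 1 := by
  simp [sMat]

lemma sMat_transpose {n : ℕ} (a b : Fin n) (t : ℝ) : (sMat a b t)ᵀ = sMat a b (-t) := by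
  simp only [sMat, Matrix.transpose_add, Matrix.transpose_smul, Matrix.transpose_sub,
    Matrix.transpose_one, Matrix.transpose_single, Real.cosh_neg, Real.sinh_neg]
  push_cast
  module

lemma sMat_tm {n : ℕ} (a b : Fin n) (hab : a ≠ b) (t : ℝ) : (sMat a b t)ᵀ * sMat a b t = 1 := by
  rw [sMat_transpose, sMat_mul a b hab]; simp [sMat_zero]

lemma sMat_det {n : ℕ} (a b : Fin n) (hab : a ≠ b) (t : ℝ) : (sMat a b t).det = 1 := by
  have h1 : sMat a b t = sMat a b (t / 2) * sMat a b (t / 2) := by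
    rw [sMat_mul a b hab]; congr 1; ring
  have h2 := congrArg Matrix.det (sMat_tm a b hab (t / 2))
  rw [Matrix.det_mul, Matrix.det_transpose, Matrix.det_one] at h2
  rw [h1, Matrix.det_mul, h2]

lemma sMat_mul_row {n : ℕ} (a b : Fin n) (t : ℝ) (B : Matrix (Fin n) (Fin n) ℂ) (i j : Fin n)
    (hi : i ≠ a) (hi' : i ≠ b) : (sMat a b t * B) i j = B i j := by
  simp [sMat, Matrix.add_mul, Matrix.sub_mul, hi, hi']

lemma H_form (p q : ℕ) (A : Matrix (Fin (p + q)) (Fin (p + q)) ℝ)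
    (hA : Aᵀ * formMat p q * A = formMat p q) :
    embedDconj p q A * cmat (formMat p q) * (embedDconj p q A)ᴴ = cmat (formMat p q) := by
  have hA' : A * formMat p q * Aᵀ = formMat p q := by
    have h1 : (formMat p q * Aᵀ * formMat p q) * A = 1 := by
      rw [Matrix.mul_assoc, Matrix.mul_assoc, ← Matrix.mul_assoc Aᵀ, hA, formMat_sq]
    have h2 := mul_eq_one_comm.mp h1
    calc A * formMat p q * Aᵀ = (A * (formMat p q * Aᵀ * formMat p q)) * formMat p q := by
          simp only [Matrix.mul_assoc, formMat_sq, Matrix.mul_one]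
      _ = _ := by rw [h2, Matrix.one_mul]
  have hc : cmat (formMat p q) =
      Matrix.diagonal fun i : Fin (p + q) => ((if (i : ℕ) < p then (1:ℝ) else -1 : ℝ) : ℂ) := by
    ext i j; by_cases hij : i = j <;> simp [cmat, formMat, hij]
  rw [hc]
  ext i j
  have h := congrFun (congrFun hA' i) j
  rw [formMat, Matrix.mul_apply] at h
  simp only [Matrix.mul_diagonal, Matrix.transpose_apply] at h
  have h' := congrArg (fun x : ℝ => (x : ℂ)) h
  simp only [Complex.ofReal_sum, Complex.ofReal_mul] at h'
  rw [Matrix.mul_apply]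
  simp only [Matrix.conjTranspose_apply, Matrix.mul_diagonal, embed_apply]
  calc _ = (if (i : ℕ) < p then (1 : ℂ) else Complex.I) *
        (if (j : ℕ) < p then (1 : ℂ) else -Complex.I) *
        ∑ k : Fin (p+q), (A i k : ℂ) * ((if (k : ℕ) < p then (1:ℝ) else -1 : ℝ) : ℂ) * (A j k : ℂ) := by
        rw [Finset.mul_sum]
        apply Finset.sum_congr rfl
        intro k _
        have e1 : (if (k : ℕ) < p then (1 : ℂ) else -Complex.I) *
          star (if (k : ℕ) < p then (1 : ℂ) else -Complex.I) = 1 := by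
          by_cases hk : (k : ℕ) < p <;> simp [hk]
        have e2 : star (if (j : ℕ) < p then (1 : ℂ) else Complex.I) =
          (if (j : ℕ) < p then (1 : ℂ) else -Complex.I) := by
          by_cases hk : (j : ℕ) < p <;> simp [hk]
        have e3 : star (A j k : ℂ) = (A j k : ℂ) := Complex.conj_ofReal _
        simp only [star_mul']
        rw [e2, e3]
        linear_combination ((if (i : ℕ) < p then (1 : ℂ) else Complex.I) *
          (if (j : ℕ) < p then (1 : ℂ) else -Complex.I) * (A i k : ℂ) *
          ((if (k : ℕ) < p then (1:ℝ) else -1 : ℝ) : ℂ) * (A j k : ℂ)) * e1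
    _ = _ := by
        rw [h', Matrix.diagonal_apply, Matrix.diagonal_apply]
        by_cases hij : i = j
        · subst hij
          by_cases hi : (i : ℕ) < p <;> simp [hi]
        · simp [hij]

lemma sMat_aa {n : ℕ} (a b : Fin n) (hab : a ≠ b) (t : ℝ) : sMat a b t a a = Real.cosh t := by
  simp [sMat, hab, hab.symm, Matrix.single_apply]

lemma sMat_ab {n : ℕ} (a b : Fin n) (hab : a ≠ b) (t : ℝ) :
    sMat a b t a b = Complex.I * Real.sinh t := by
  simp [sMat, hab, hab.symm, Matrix.single_apply, Matrix.one_apply]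

lemma sMat_conjTranspose {n : ℕ} (a b : Fin n) (t : ℝ) : (sMat a b t)ᴴ = sMat a b t := by
  simp only [sMat, Matrix.conjTranspose_add, Matrix.conjTranspose_smul, Matrix.conjTranspose_sub,
    Matrix.conjTranspose_one, Matrix.conjTranspose_single, star_one, star_mul', star_sub,
    Complex.star_def, Complex.conj_ofReal, Complex.conj_I]
  module

lemma sMat_form (p q : ℕ) (a b : Fin (p + q)) (hab : a ≠ b) (hP : (a : ℕ) < p ↔ (b : ℕ) < p)
    (t : ℝ) : ‖(sMat a b t * cmat (formMat p q) * (sMat a b t)ᴴ) a a‖ = Real.cosh (2 * t) := by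
  have hc : cmat (formMat p q) =
      Matrix.diagonal fun i : Fin (p + q) => ((if (i : ℕ) < p then (1:ℝ) else -1 : ℝ) : ℂ) := by
    ext i j; by_cases hij : i = j <;> simp [cmat, formMat, hij]
  let ε : ℝ := if (a : ℕ) < p then 1 else -1
  have hcomm : sMat a b t * cmat (formMat p q) = cmat (formMat p q) * sMat a b t := by
    rw [hc]
    ext i j
    rw [Matrix.mul_diagonal, Matrix.diagonal_mul]
    by_cases hij : i = j
    · subst hij; ring
    · by_cases h1 : i = a
      · by_cases h2 : j = b
        · subst h1 h2
          simp only [hP]; ring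
        · have : sMat a b t i j = 0 := by
            subst h1
            simp [sMat, Matrix.single_apply, hij, hab, hab.symm, Ne.symm h2]
          rw [this]; simp
      · by_cases h2 : i = b
        · by_cases h3 : j = a
          · subst h2 h3
            simp only [hP]; ring
          · have : sMat a b t i j = 0 := by
              subst h2
              simp [sMat, Matrix.single_apply, hij, hab, hab.symm, Ne.symm h3]
            rw [this]; simp
        · have : sMat a b t i j = 0 := by
            simp [sMat, Matrix.single_apply, hij, Ne.symm h1, Ne.symm h2]
          rw [this]; simp
  rw [hcomm, sMat_conjTranspose, Matrix.mul_assoc, sMat_mul a b hab, hc, Matrix.diagonal_mul,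
    sMat_aa a b hab, norm_mul, Complex.norm_real, Complex.norm_real, ← two_mul,
    Real.norm_of_nonneg (Real.cosh_pos _).le]
  by_cases h : (a : ℕ) < p <;> simp [h]

lemma Hsub_elim (p q : ℕ) (h : SOC (p + q)) (hh : h ∈ Hsub p q) :
    ∃ A : Matrix (Fin (p + q)) (Fin (p + q)) ℝ, Aᵀ * formMat p q * A = formMat p q ∧
      mat h = embedDconj p q A := by
  obtain ⟨A, hA, hAh⟩ := hh
  obtain ⟨B, _, rfl⟩ := hA
  exact ⟨_, B.2, congrArg Units.val hAh.symm⟩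

lemma main_aux (p q : ℕ) (hp : 2 ≤ p) (hq : 2 ≤ q) :
    ∃ (P : Fin (p + q) → Prop) (a b : Fin (p + q)), a ≠ b ∧ ((a : ℕ) < p ↔ (b : ℕ) < p) ∧
      ¬ P a ∧ ¬ P b ∧ (∀ i j, P i → P j → ((i : ℕ) < p ↔ (j : ℕ) < p)) ∧
      ∀ M : Matrix (Fin (p + q)) (Fin (p + q)) ℝ, (∀ i j, P i → P j → M i j = 0) →
        M.rank ≤ 2 * min p q := by
  rcases le_or_gt q p with h | h
  · refine ⟨fun i => (i : ℕ) < p, ⟨p, by omega⟩, ⟨p + 1, by omega⟩, ?_, ?_, ?_, ?_, ?_, ?_⟩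
    · simp [Fin.ext_iff]
    · simp
    · simp
    · simp
    · intro i j hi hj; exact iff_of_true hi hj
    · intro M hM
      have := rank_block M _ hM
      have h2 := card_ge_block p q
      rw [min_eq_right h]
      omega
  · refine ⟨fun i => ¬ (i : ℕ) < p, ⟨0, by omega⟩, ⟨1, by omega⟩, ?_, ?_, ?_, ?_, ?_, ?_⟩
    · simp [Fin.ext_iff]
    · simp; omega
    · simp; omega
    · simp; omega
    · intro i j hi hj; exact iff_of_false hi hj
    · intro M hM
      have := rank_block M _ hM
      have h2 := card_lt_block p q
      simp only [not_not] at this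
      rw [min_eq_left h.le]
      omega

lemma main_thm (p q : ℕ) (hp : 2 ≤ p) (hq : 2 ≤ q) :
    ¬ AdmitsCompactCliffordKleinForm (Hsub p q) := by
  rintro ⟨Γ, _, hpd, _, hcpt⟩
  obtain ⟨P, a, b, hab, habp, hPa, hPb, hPP, hrank⟩ := main_aux p q hp hq
  obtain ⟨R, hR⟩ : ∃ R : ℝ, ∀ g : SOC (p + q), ∃ γ ∈ Γ, ∃ c ∈ KR (p + q) R, ∃ h ∈ Hsub p q,
      g = γ * c * h := by
    obtain ⟨k, hk⟩ := cocompact_cover (Hsub p q) Γ hcpt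
      (fun k : ℕ => {g | ∀ i j, ‖mat g i j‖ < k}) (by
        intro k
        simp only [Set.ofPred_forall]
        refine isOpen_iInter_of_finite fun i => isOpen_iInter_of_finite fun j => ?_
        exact isOpen_lt ((continuous_mat.matrix_elem i j).norm) continuous_const)
      (by
        intro k l hkl g hg i j
        exact (hg i j).trans_le (by exact_mod_cast hkl))
      (by
        intro g
        obtain ⟨k, hk⟩ := exists_nat_gt (∑ i, ∑ j, ‖mat g i j‖)
        refine ⟨k, fun i j => lt_of_le_of_lt ?_ hk⟩
        calc ‖mat g i j‖ ≤ ∑ j, ‖mat g i j‖ :=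
              Finset.single_le_sum (f := fun j => ‖mat g i j‖) (fun _ _ => norm_nonneg _)
                (Finset.mem_univ j)
          _ ≤ _ := Finset.single_le_sum (f := fun i => ∑ j, ‖mat g i j‖)
                (fun _ _ => Finset.sum_nonneg fun _ _ => norm_nonneg _) (Finset.mem_univ i))
    refine ⟨k, fun g => ?_⟩
    obtain ⟨γ, hγ, c, hc, h, hh, e⟩ := hk g
    exact ⟨γ, hγ, c, fun i j => (hc i j).le, h, hh, e⟩
  let π : SOC (p + q) → SOC (p + q) ⧸ Hsub p q := fun g => (g : SOC (p + q) ⧸ Hsub p q)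
  have hπ : Continuous π := QuotientGroup.continuous_mk
  let K : Set (SOC (p + q) ⧸ Hsub p q) :=
    π '' ((fun x : SOC (p + q) × SOC (p + q) => x.1 * x.2⁻¹) '' (KR (p + q) R ×ˢ KR (p + q) 1))
  let L : Set (SOC (p + q) ⧸ Hsub p q) := π '' (KR (p + q) 1)
  have hK : IsCompact K := (((KR_compact _ _).prod (KR_compact _ _)).image
    (continuous_fst.mul continuous_snd.inv)).image hπ
  have hL : IsCompact L := (KR_compact _ _).image hπ
  have hfin := hpd.finite_disjoint_inter_image hK hL
  set Fs : Set Γ := {γ : Γ | ((fun x => γ • x) '' K ∩ L).Nonempty} with hFs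
  let X : Set (SOC (p + q)) := (fun x : SOC (p + q) × SOC (p + q) => x.1 * x.2) ''
    ((Subtype.val '' Fs) ×ˢ KR (p + q) R)
  have hX : IsCompact X :=
    ((hfin.image Subtype.val).isCompact.prod (KR_compact _ _)).image continuous_mul
  have hcont : Continuous fun x : SOC (p + q) =>
      (mat x * cmat (formMat p q) * (mat x)ᴴ) a a := by
    have hm := continuous_mat (n := p + q)
    exact ((hm.mul continuous_const).mul hm.matrix_conjTranspose).matrix_elem a a
  obtain ⟨C, hC⟩ := hX.exists_bound_of_continuousOn hcont.continuousOn
  have key : ∀ t : ℝ, Real.cosh (2 * t) ≤ C := by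
    intro t
    let s : SOC (p + q) := mkSOC (sMat a b t) (sMat_tm a b hab t) (sMat_det a b hab t)
    obtain ⟨γ, hγ, c, hc, h, hh, e⟩ := hR s
    have hr : ((mat (s * h⁻¹)).map Complex.im).rank ≤ 2 * min p q := by
      apply hrank
      intro i j hi hj
      obtain ⟨A, _, hA⟩ := Hsub_elim p q h⁻¹ (inv_mem hh)
      rw [Matrix.map_apply, mat_mul, hA]
      change ((sMat a b t * embedDconj p q A) i j).im = 0
      rw [sMat_mul_row a b t _ i j (fun e => hPa (e ▸ hi)) (fun e => hPb (e ▸ hi)), embed_apply]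
      have := hPP i j hi hj
      by_cases hip : (i : ℕ) < p
      · have hjp := this.mp hip
        simp [hip, hjp]
      · have hjp : ¬ (j : ℕ) < p := fun h => hip (this.mpr h)
        simp [hip, hjp]
    obtain ⟨k1, h', k2, hk1, hk2, hh', e'⟩ := decomp p q (by omega) (s * h⁻¹) hr
    have hγF : (⟨γ, hγ⟩ : Γ) ∈ Fs := by
      refine ⟨π k1, ⟨π (c * k2⁻¹), ⟨_, ⟨(c, k2), ⟨hc, hk2⟩, rfl⟩, rfl⟩, ?_⟩, ⟨k1, hk1, rfl⟩⟩
      change ((γ * (c * k2⁻¹) : SOC (p + q)) : SOC (p + q) ⧸ Hsub p q) = (k1 : SOC (p + q))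
      have e2 : γ * (c * k2⁻¹) = k1 * h' := by
        have : s * h⁻¹ = γ * c := by rw [e]; group
        rw [this] at e'
        rw [← mul_assoc, e']; group
      rw [e2]
      symm
      rw [QuotientGroup.eq]
      simpa using hh'
    have hx := hC (γ * c) ⟨(γ, c), ⟨⟨⟨γ, hγ⟩, hγF, rfl⟩, hc⟩, rfl⟩
    obtain ⟨A, hA1, hA⟩ := Hsub_elim p q h hh
    have hs : mat s = mat (γ * c) * embedDconj p q A := by rw [e, mat_mul, hA]
    have hs2 : sMat a b t * cmat (formMat p q) * (sMat a b t)ᴴ =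
        mat (γ * c) * cmat (formMat p q) * (mat (γ * c))ᴴ := by
      change mat s * cmat (formMat p q) * (mat s)ᴴ = _
      conv_rhs => rw [← H_form p q A hA1]
      rw [hs, Matrix.conjTranspose_mul]
      simp only [Matrix.mul_assoc]
    rw [← sMat_form p q a b hab habp t, hs2]
    exact hx
  have h1 := key (C / 2)
  have h2 := Real.add_one_le_exp C
  have h3 := key 0
  simp only [mul_zero, Real.cosh_zero] at h3
  have h4 : Real.cosh (2 * (C / 2)) = Real.cosh C := by congr 1; ring
  have h5 : C < Real.sinh C := Real.self_lt_sinh_iff.mpr (by linarith)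
  have h6 := Real.sinh_lt_cosh C
  linarith

/-- For all integers `p, q ≥ 2` with `(p,q) ≠ (2,2)`, the irreducible
symmetric space `SO(p+q,ℂ)/SO₀(p,q)` does not admit a compact Clifford–Klein form; here
`SO₀(p,q)` is embedded into `SO(p+q,ℂ)` via `A ↦ D A D⁻¹` with `D = diag(1_p, √−1·1_q)`. -/
theorem statement6 (p q : ℕ) (hp : 2 ≤ p) (hq : 2 ≤ q) (hpq : ¬(p = 2 ∧ q = 2)) :
    ¬ AdmitsCompactCliffordKleinForm
      ((Subgroup.map (Units.map (embedDconj p q)) (SOZero p q)).subgroupOf (SOC (p + q))) := by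
  exact main_thm p q hp hq

end
end

section
/- For every integer n ≥ 1, the irreducible symmetric space SO(2n+1,ℂ)/SO₀(2n,1) does not admit a compact Clifford–Klein form; that is, there is no discrete subgroup Γ of SO(2n+1,ℂ) whose left-translation action on SO(2n+1,ℂ)/SO₀(2n,1) is properly discontinuous and free and has compact quotient. -/
/-! Statement 7: For every integer `n ≥ 1`, the irreducible symmetric space
`SO(2n+1,ℂ)/SO₀(2n,1)` does not admit a compact Clifford–Klein form. -/

open Matrix

noncomputable section

namespace HB
open MeasureTheory Polynomial Metric Set

lemma poly_contra {m : ℕ} (hm : Odd m) (Q : ℝ[X]) (h : Q ^ 2 = (1 + X ^ 2) ^ m) : False := by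
  have h1 : (Q.map Complex.ofRealHom) ^ 2 = ((X - C Complex.I) * (X - C (-Complex.I))) ^ m := by
    have := congrArg (Polynomial.map Complex.ofRealHom) h
    simp only [Polynomial.map_pow, Polynomial.map_add, Polynomial.map_one, Polynomial.map_X] at this
    rw [this]
    congr 1
    have : (C Complex.I : ℂ[X]) * C Complex.I = -1 := by
      rw [← C_mul, Complex.I_mul_I]; simp
    simp only [C_neg]
    linear_combination this
  have h2 := congrArg (fun p : ℂ[X] => p.roots.count Complex.I) h1
  simp only [roots_pow, Multiset.count_nsmul] at h2
  rw [roots_mul (mul_ne_zero (X_sub_C_ne_zero _) (X_sub_C_ne_zero _)), roots_X_sub_C,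
    roots_X_sub_C, Multiset.count_add, Multiset.count_singleton_self,
    Multiset.count_singleton] at h2
  have : Complex.I ≠ -Complex.I := by
    intro h
    have := congrArg Complex.im h
    simp at this
    norm_num at this
  rw [if_neg this] at h2
  obtain ⟨k, hk⟩ := hm
  omega

lemma det_poly {m : ℕ} (A : EuclideanSpace ℝ (Fin m) →L[ℝ] EuclideanSpace ℝ (Fin m)) :
    ∃ p : ℝ[X], p.degree < (m + 1 : ℕ) ∧ ∀ t, p.eval t =
      (ContinuousLinearMap.id ℝ _ + t • A).det := by
  let b := (EuclideanSpace.basisFun (Fin m) ℝ).toBasis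
  let M := LinearMap.toMatrix b b (A : EuclideanSpace ℝ (Fin m) →ₗ[ℝ] EuclideanSpace ℝ (Fin m))
  refine ⟨det ((X : ℝ[X]) • M.map C + (1 : Matrix (Fin m) (Fin m) ℝ).map C), ?_, ?_⟩
  · refine lt_of_le_of_lt degree_le_natDegree ?_
    have := natDegree_det_X_add_C_le M 1
    simp only [Fintype.card_fin] at this
    exact_mod_cast Nat.lt_succ_of_le this
  · intro t
    rw [ContinuousLinearMap.det, ← LinearMap.det_toMatrix b, ← coe_evalRingHom, RingHom.map_det]
    congr 1
    have : ((ContinuousLinearMap.id ℝ _ + t • A : EuclideanSpace ℝ (Fin m) →L[ℝ] _) :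
      EuclideanSpace ℝ (Fin m) →ₗ[ℝ] EuclideanSpace ℝ (Fin m)) = LinearMap.id + t • (A : _ →ₗ[ℝ] _) := rfl
    rw [this, map_add (LinearMap.toMatrix b b), map_smul (LinearMap.toMatrix b b), LinearMap.toMatrix_id]
    ext i j
    simp only [RingHom.mapMatrix_apply, Matrix.map_apply, Matrix.add_apply, Matrix.smul_apply,
      smul_eq_mul, coe_evalRingHom, eval_add, eval_mul, eval_X, eval_C]
    rw [add_comm]

lemma det_pos {m : ℕ} (A : EuclideanSpace ℝ (Fin m) →L[ℝ] EuclideanSpace ℝ (Fin m))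
    (K t : ℝ) (hA : ‖A‖ ≤ K) (ht : 0 ≤ t) (htK : t * K < 1) :
    0 < (ContinuousLinearMap.id ℝ _ + t • A).det := by
  obtain ⟨p, -, hp⟩ := det_poly A
  rw [← hp]
  by_contra! hneg
  have h0 : p.eval 0 = 1 := by
    have : ContinuousLinearMap.id ℝ (EuclideanSpace ℝ (Fin m)) + (0:ℝ) • A = ContinuousLinearMap.id ℝ _ := by
      ext x; simp
    rw [hp, this]
    exact LinearMap.det_id
  have : (0:ℝ) ∈ (fun s => p.eval s) '' Icc 0 t := by
    apply intermediate_value_Icc' ht p.continuous.continuousOn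
    exact ⟨hneg, by rw [h0]; exact zero_le_one⟩
  obtain ⟨s, ⟨hs0, hst⟩, hs⟩ := this
  simp only at hs
  rw [hp, ContinuousLinearMap.det, ← not_not (a := _ = _)] at hs
  apply hs
  have hK : 0 ≤ K := (norm_nonneg _).trans hA
  have hinj : Function.Injective ((ContinuousLinearMap.id ℝ (EuclideanSpace ℝ (Fin m)) + s • A : _ →L[ℝ] _) : EuclideanSpace ℝ (Fin m) →ₗ[ℝ] EuclideanSpace ℝ (Fin m)) := by
    rw [← LinearMap.ker_eq_bot, LinearMap.ker_eq_bot']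
    intro v hv
    have hv : v + s • A v = 0 := hv
    by_contra hne
    have hv' : v = -(s • A v) := eq_neg_of_add_eq_zero_left hv
    have h1 : ‖v‖ ≤ s * (K * ‖v‖) := by
      conv_lhs => rw [hv']
      rw [norm_neg, norm_smul, Real.norm_of_nonneg hs0]
      gcongr
      exact A.le_of_opNorm_le hA v
    have h2 : s * K ≤ t * K := by gcongr
    have h3 : 0 < ‖v‖ := norm_pos_iff.mpr hne
    nlinarith
  have := LinearMap.isUnit_det _ ((LinearMap.isUnit_iff_ker_eq_bot _).mpr (LinearMap.ker_eq_bot.mpr hinj))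
  exact this.ne_zero

lemma vol_formula {m : ℕ} (hm : 0 < m) (V : EuclideanSpace ℝ (Fin m) → EuclideanSpace ℝ (Fin m))
    (K : NNReal) (hV : LipschitzWith K V) (hdiff : ∀ x, x ≠ 0 → DifferentiableAt ℝ V x)
    (horth : ∀ x, inner ℝ x (V x) = 0) (hnorm : ∀ x, ‖V x‖ = ‖x‖)
    (t : ℝ) (ht : 0 ≤ t) (htK : t * K < 1) :
    IntegrableOn (fun x => (ContinuousLinearMap.id ℝ _ + t • fderiv ℝ V x).det)
      (ball 0 1 \ {0}) ∧
    ∫ x in (ball 0 1 \ {0}), (ContinuousLinearMap.id ℝ _ + t • fderiv ℝ V x).det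
      = √(1 + t ^ 2) ^ m * volume.real (ball (0 : EuclideanSpace ℝ (Fin m)) 1) := by
  have : Nonempty (Fin m) := ⟨⟨0, hm⟩⟩
  set f : EuclideanSpace ℝ (Fin m) → EuclideanSpace ℝ (Fin m) := fun x => x + t • V x with hf
  set s : Set (EuclideanSpace ℝ (Fin m)) := ball 0 1 \ {0} with hs
  have hsm : MeasurableSet s := measurableSet_ball.diff (measurableSet_singleton _)
  have hfn : ∀ x, ‖f x‖ = √(1 + t ^ 2) * ‖x‖ := by
    intro x
    rw [← sq_eq_sq₀ (norm_nonneg _) (by positivity), mul_pow, Real.sq_sqrt (by positivity), hf]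
    simp only
    rw [norm_add_sq_real, inner_smul_right, horth, norm_smul, hnorm, mul_pow]
    simp
    ring
  have happ : ApproximatesLinearOn f ((ContinuousLinearEquiv.refl ℝ (EuclideanSpace ℝ (Fin m)) :
      EuclideanSpace ℝ (Fin m) ≃L[ℝ] EuclideanSpace ℝ (Fin m)) : _ →L[ℝ] _) univ (Real.toNNReal t * K) := by
    intro x _ y _
    have : f x - f y - ((ContinuousLinearEquiv.refl ℝ (EuclideanSpace ℝ (Fin m)) : _ →L[ℝ] _)) (x - y) = t • (V x - V y) := by
      simp [hf, smul_sub]; abel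
    rw [this, norm_smul, Real.norm_of_nonneg ht, NNReal.coe_mul, Real.coe_toNNReal _ ht, mul_assoc]
    gcongr
    exact hV.norm_sub_le x y
  have hc : Subsingleton (EuclideanSpace ℝ (Fin m)) ∨ Real.toNNReal t * K <
      ‖((ContinuousLinearEquiv.refl ℝ (EuclideanSpace ℝ (Fin m))).symm : EuclideanSpace ℝ (Fin m) →L[ℝ] EuclideanSpace ℝ (Fin m))‖₊⁻¹ := by
    right
    have : ‖((ContinuousLinearEquiv.refl ℝ (EuclideanSpace ℝ (Fin m))).symm : EuclideanSpace ℝ (Fin m) →L[ℝ] EuclideanSpace ℝ (Fin m))‖₊ = 1 := by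
      apply NNReal.eq
      simp
    rw [this, inv_one, ← NNReal.coe_lt_coe]
    simpa [ht] using htK
  have hinj : Function.Injective f := injOn_univ.mp (happ.injOn hc)
  have hsurj : Function.Surjective f := happ.surjective hc
  have hpos : 0 < √(1 + t ^ 2) := by positivity
  have himg : f '' s = ball 0 (√(1 + t ^ 2)) \ {0} := by
    ext y
    constructor
    · rintro ⟨x, ⟨hx1, hx2⟩, rfl⟩
      refine ⟨?_, ?_⟩
      · simp only [mem_ball_zero_iff] at hx1 ⊢
        rw [hfn]; nlinarith
      · simp only [mem_singleton_iff] at hx2 ⊢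
        rw [← norm_eq_zero, hfn]
        have := norm_pos_iff.mpr hx2
        positivity
    · rintro ⟨h1, h2⟩
      obtain ⟨x, rfl⟩ := hsurj y
      refine ⟨x, ⟨?_, ?_⟩, rfl⟩
      · simp only [mem_ball_zero_iff] at h1 ⊢
        rw [hfn] at h1; 
        by_contra! h
        nlinarith
      · rintro rfl
        apply h2
        simp only [mem_singleton_iff]
        rw [← norm_eq_zero, hfn]; simp
  have hder : ∀ x ∈ s, HasFDerivWithinAt f (ContinuousLinearMap.id ℝ _ + t • fderiv ℝ V x) s x := by
    intro x hx
    exact ((hasFDerivAt_id x).add ((hdiff x hx.2).hasFDerivAt.const_smul t)).hasFDerivWithinAt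
  have hd0 : ∀ x ∈ s, |(ContinuousLinearMap.id ℝ _ + t • fderiv ℝ V x).det| • (1:ℝ) = (ContinuousLinearMap.id ℝ _ + t • fderiv ℝ V x).det := by
    intro x hx
    rw [smul_eq_mul, mul_one, abs_of_pos]
    exact det_pos _ K t (norm_fderiv_le_of_lipschitz ℝ hV) ht htK
  have e1 := integral_image_eq_integral_abs_det_fderiv_smul volume hsm hder hinj.injOn (fun _ => (1:ℝ))
  have e2 := integrableOn_image_iff_integrableOn_abs_det_fderiv_smul volume hsm hder hinj.injOn (fun _ => (1:ℝ))
  rw [setIntegral_congr_fun hsm hd0, himg] at e1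
  rw [integrableOn_congr_fun hd0 hsm, himg] at e2
  constructor
  · rw [← e2]
    apply integrableOn_const
    · exact (measure_lt_top_of_subset sdiff_subset measure_ball_lt_top.ne).ne
    · simp
  · rw [← e1]
    have : volume (ball (0 : EuclideanSpace ℝ (Fin m)) (√(1 + t ^ 2)) \ {0}) = volume (ball (0 : EuclideanSpace ℝ (Fin m)) (√(1 + t ^ 2))) :=
      measure_sdiff_null (measure_singleton _)
    rw [setIntegral_const, measureReal_def, this, Measure.addHaar_ball_of_pos _ _ hpos,
      ENNReal.toReal_mul, ENNReal.toReal_ofReal (by positivity), finrank_euclideanSpace_fin, smul_eq_mul, mul_one, measureReal_def]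

lemma hairy_lipschitz {m : ℕ} (hm : Odd m) (V : EuclideanSpace ℝ (Fin m) → EuclideanSpace ℝ (Fin m))
    (K : NNReal) (hV : LipschitzWith K V) (hdiff : ∀ x, x ≠ 0 → DifferentiableAt ℝ V x)
    (horth : ∀ x, inner ℝ x (V x) = 0) (hnorm : ∀ x, ‖V x‖ = ‖x‖) : False := by
  have hm0 : 0 < m := hm.pos
  set s : Set (EuclideanSpace ℝ (Fin m)) := ball 0 1 \ {0} with hs
  set v := volume.real (ball (0 : EuclideanSpace ℝ (Fin m)) 1) with hv
  have hvpos : 0 < v := by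
    rw [hv, measureReal_def]
    exact ENNReal.toReal_pos (measure_ball_pos _ _ one_pos).ne' measure_ball_lt_top.ne
  have hvf := fun t ht htK => vol_formula hm0 V K hV hdiff horth hnorm t ht htK
  choose p hpd hp using fun x => det_poly (fderiv ℝ V x)
  -- nodes
  set ε : ℝ := 1 / (K + 1) with hε
  have hεpos : 0 < ε := by positivity
  have hεK : ∀ t, t ≤ ε → t * K < 1 := by
    intro t ht
    have : t * K ≤ ε * K := by gcongr
    refine lt_of_le_of_lt this ?_
    rw [hε, div_mul_eq_mul_div, div_lt_one (by positivity)]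
    simp
  let nd : ℕ → ℝ := fun i => ε / (i + 1)
  have hnd : ∀ i, 0 ≤ nd i ∧ nd i ≤ ε := fun i => ⟨by positivity, by
    simp only [nd]; apply div_le_self hεpos.le; linarith [(Nat.cast_nonneg i : (0:ℝ) ≤ i)]⟩
  have hndinj : Function.Injective nd := by
    intro i j hij
    simp only [nd] at hij
    field_simp at hij
    have : (i:ℝ) = j := by linarith
    exact_mod_cast this
  let r : ℕ → ℝ := fun i => ∫ x in s, (p x).eval (nd i)
  let Q : ℝ[X] := Lagrange.interpolate (Finset.range (m + 1)) nd r
  have hint : ∀ t, 0 ≤ t → t ≤ ε → IntegrableOn (fun x => (p x).eval t) s ∧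
      ∫ x in s, (p x).eval t = √(1 + t ^ 2) ^ m * v := by
    intro t h0 h1
    simp only [hp]
    exact hvf t h0 (hεK t h1)
  have hQ : ∀ t, 0 ≤ t → t ≤ ε → Q.eval t = √(1 + t ^ 2) ^ m * v := by
    intro t h0 h1
    rw [← (hint t h0 h1).2]
    have : ∀ x, (p x).eval t = ∑ i ∈ Finset.range (m + 1), (p x).eval (nd i) * (Lagrange.basis (Finset.range (m+1)) nd i).eval t := by
      intro x
      have := Lagrange.eq_interpolate (f := p x) (s := Finset.range (m+1)) (v := nd) hndinj.injOn (by simpa using hpd x)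
      conv_lhs => rw [this]
      simp [Lagrange.interpolate_apply, eval_finsetSum]
    simp only [this]
    rw [integral_finsetSum]
    · simp only [Q, Lagrange.interpolate_apply, eval_finsetSum, eval_mul, eval_C, r]
      refine Finset.sum_congr rfl fun i _ => ?_
      rw [integral_mul_const]
    · intro i _
      exact (hint _ (hnd i).1 (hnd i).2).1.mul_const _
  apply poly_contra hm (C v⁻¹ * Q)
  apply Polynomial.eq_of_infinite_eval_eq
  apply Set.Infinite.mono _ (Set.Icc_infinite hεpos)
  intro t ht
  simp only [mem_ofPred_eq, eval_pow, eval_mul, eval_C, eval_add, eval_one, eval_X]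
  rw [hQ t ht.1 ht.2]
  rw [mul_comm, mul_assoc, mul_inv_cancel₀ hvpos.ne', mul_one, ← pow_mul, mul_comm m 2, pow_mul,
    Real.sq_sqrt (by positivity)]

lemma hairy_smooth {m : ℕ} (hm : Odd m)
    (w : EuclideanSpace ℝ (Fin m) → EuclideanSpace ℝ (Fin m))
    (hw : ContDiff ℝ 1 w) (horth : ∀ x, ‖x‖ = 1 → inner ℝ x (w x) = 0)
    (hnorm : ∀ x, ‖x‖ = 1 → ‖w x‖ = 1) : False := by
  obtain ⟨K, hK⟩ := hw.contDiffOn.exists_lipschitzOnWith one_ne_zero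
    (convex_closedBall (0 : EuclideanSpace ℝ (Fin m)) 1) (isCompact_closedBall _ _)
  have hunit : ∀ x : EuclideanSpace ℝ (Fin m), x ≠ 0 → ‖‖x‖⁻¹ • x‖ = 1 := by
    intro x hx
    have := norm_pos_iff.mpr hx
    rw [norm_smul, norm_inv, norm_norm, inv_mul_cancel₀ this.ne']
  have hVn : ∀ x, ‖‖x‖ • w (‖x‖⁻¹ • x)‖ = ‖x‖ := by
    intro x
    rcases eq_or_ne x 0 with rfl | hx
    · simp
    · rw [norm_smul, norm_norm, hnorm _ (hunit x hx), mul_one]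
  refine hairy_lipschitz hm (fun x => ‖x‖ • w (‖x‖⁻¹ • x)) (1 + 2 * K) ?_ ?_ ?_ hVn
  · apply LipschitzWith.of_dist_le_mul
    intro x y
    rw [dist_eq_norm, dist_eq_norm]
    rcases eq_or_ne x 0 with rfl | hx
    · simp only [norm_zero, zero_smul, zero_sub, norm_neg, hVn]
      have : (0:ℝ) ≤ K := K.2
      push_cast
      nlinarith [norm_nonneg y]
    rcases eq_or_ne y 0 with rfl | hy
    · simp only [norm_zero, zero_smul, sub_zero, hVn]
      have : (0:ℝ) ≤ K := K.2
      push_cast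
      nlinarith [norm_nonneg x]
    have hx' := norm_pos_iff.mpr hx
    have hy' := norm_pos_iff.mpr hy
    have e1 : ‖x‖ • w (‖x‖⁻¹ • x) - ‖y‖ • w (‖y‖⁻¹ • y) =
      (‖x‖ - ‖y‖) • w (‖x‖⁻¹ • x) + ‖y‖ • (w (‖x‖⁻¹ • x) - w (‖y‖⁻¹ • y)) := by
      rw [sub_smul, smul_sub]; abel
    have e2 : ‖w (‖x‖⁻¹ • x) - w (‖y‖⁻¹ • y)‖ ≤ K * ‖‖x‖⁻¹ • x - ‖y‖⁻¹ • y‖ :=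
      hK.norm_sub_le (by simp [hunit x hx]) (by simp [hunit y hy])
    have e3 : ‖y‖ * ‖‖x‖⁻¹ • x - ‖y‖⁻¹ • y‖ ≤ 2 * ‖x - y‖ := by
      have : ‖y‖ * ‖‖x‖⁻¹ • x - ‖y‖⁻¹ • y‖ = ‖(‖y‖ - ‖x‖) • (‖x‖⁻¹ • x) + (x - y)‖ := by
        have : (‖y‖ - ‖x‖) • (‖x‖⁻¹ • x) + (x - y) = ‖y‖ • (‖x‖⁻¹ • x - ‖y‖⁻¹ • y) := by
          rw [sub_smul, smul_sub, smul_inv_smul₀ hx'.ne', smul_inv_smul₀ hy'.ne']; abel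
        rw [this, norm_smul, norm_norm]
      rw [this]
      refine (norm_add_le _ _).trans ?_
      rw [norm_smul, hunit x hx, mul_one, Real.norm_eq_abs]
      have := abs_norm_sub_norm_le y x
      rw [norm_sub_rev y x] at this
      linarith
    rw [e1]
    refine (norm_add_le _ _).trans ?_
    rw [norm_smul, norm_smul, hnorm _ (hunit x hx), mul_one, Real.norm_eq_abs, norm_norm]
    have e4 := abs_norm_sub_norm_le x y
    have e5 : ‖y‖ * ‖w (‖x‖⁻¹ • x) - w (‖y‖⁻¹ • y)‖ ≤ K * (2 * ‖x - y‖) := by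
      calc _ ≤ ‖y‖ * (K * ‖‖x‖⁻¹ • x - ‖y‖⁻¹ • y‖) := by gcongr
        _ = K * (‖y‖ * ‖‖x‖⁻¹ • x - ‖y‖⁻¹ • y‖) := by ring
        _ ≤ _ := by gcongr
    push_cast
    linarith
  · intro x hx
    have hn : DifferentiableAt ℝ (fun x : EuclideanSpace ℝ (Fin m) => ‖x‖) x :=
      (differentiableAt_id).norm ℝ hx
    refine hn.smul ?_
    exact (hw.differentiable one_ne_zero _).comp x
      ((hn.inv (norm_ne_zero_iff.mpr hx)).smul differentiableAt_id)
  · intro x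
    rcases eq_or_ne x 0 with rfl | hx
    · simp
    · have := horth _ (hunit x hx)
      rw [inner_smul_left] at this
      rw [inner_smul_right]
      have hx' := norm_pos_iff.mpr hx
      simp only [map_inv₀, conj_trivial, mul_eq_zero, inv_eq_zero] at this
      rcases this with h | h
      · exact absurd h hx'.ne'
      · rw [h, mul_zero]

open scoped Manifold ContDiff Topology in
theorem hairy_ball {m : ℕ} (hm : Odd m)
    (V : EuclideanSpace ℝ (Fin m) → EuclideanSpace ℝ (Fin m))
    (hV : ContinuousOn V (sphere 0 1)) (horth : ∀ x ∈ sphere 0 1, inner ℝ x (V x) = 0) :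
    ∃ x ∈ sphere (0 : EuclideanSpace ℝ (Fin m)) 1, V x = 0 := by
  by_contra! hne
  have : Nonempty (Fin m) := ⟨⟨0, hm.pos⟩⟩
  have hS : IsCompact (sphere (0 : EuclideanSpace ℝ (Fin m)) 1) := isCompact_sphere _ _
  have hSne : (sphere (0 : EuclideanSpace ℝ (Fin m)) 1).Nonempty :=
    NormedSpace.sphere_nonempty.mpr zero_le_one
  obtain ⟨x0, hx0, hmin⟩ := hS.exists_isMinOn hSne hV.norm
  set δ := ‖V x0‖ with hδ
  have hδpos : 0 < δ := norm_pos_iff.mpr (hne x0 hx0)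
  have hmin' : ∀ x ∈ sphere (0 : EuclideanSpace ℝ (Fin m)) 1, δ ≤ ‖V x‖ := fun x hx => hmin hx
  classical
  obtain ⟨p, hp⟩ := exists_contMDiffMap_forall_mem_convex_of_local_const (n := 1)
    𝓘(ℝ, EuclideanSpace ℝ (Fin m))
    (M := EuclideanSpace ℝ (Fin m)) (F := EuclideanSpace ℝ (Fin m))
    (t := fun x => if x ∈ sphere (0 : EuclideanSpace ℝ (Fin m)) 1 then ball (V x) δ else univ)
    (by
      intro x
      split_ifs
      · exact convex_ball _ _
      · exact convex_univ)
    (by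
      intro x
      by_cases hx : x ∈ sphere (0 : EuclideanSpace ℝ (Fin m)) 1
      · refine ⟨V x, ?_⟩
        have := hV x hx
        have h2 := this (ball_mem_nhds (V x) hδpos)
        rw [Filter.mem_map, mem_nhdsWithin_iff_eventually] at h2
        filter_upwards [h2] with y hy
        split_ifs with h
        · rw [mem_ball_comm]
          exact hy h
        · trivial
      · refine ⟨0, ?_⟩
        have : (sphere (0 : EuclideanSpace ℝ (Fin m)) 1)ᶜ ∈ 𝓝 x :=
          hS.isClosed.isOpen_compl.mem_nhds hx
        filter_upwards [this] with y hy
        rw [if_neg hy]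
        trivial)
  have hpc : ContDiff ℝ 1 (p : EuclideanSpace ℝ (Fin m) → EuclideanSpace ℝ (Fin m)) :=
    p.contMDiff.contDiff
  set u : EuclideanSpace ℝ (Fin m) → EuclideanSpace ℝ (Fin m) :=
    fun x => p x - (inner ℝ x (p x)) • x with hu
  have huc : ContDiff ℝ 1 u := hpc.sub ((contDiff_id.inner ℝ hpc).smul contDiff_id)
  have hu0 : ∀ x ∈ sphere (0 : EuclideanSpace ℝ (Fin m)) 1, u x ≠ 0 := by
    intro x hx h0
    have h1 := hp x
    rw [if_pos hx, mem_ball, dist_eq_norm] at h1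
    have hx1 : ‖x‖ = 1 := by simpa using hx
    have h2 : p x = (inner ℝ x (p x)) • x := sub_eq_zero.mp h0
    have h3 : ‖p x - V x‖ ^ 2 ≥ ‖V x‖ ^ 2 := by
      rw [norm_sub_sq_real]
      have : inner ℝ (p x) (V x) = 0 := by
        rw [h2, inner_smul_left, horth x hx, mul_zero]
      rw [this]
      nlinarith [sq_nonneg ‖p x‖]
    have h4 := hmin' x hx
    have h5 : ‖p x - V x‖ ^ 2 < δ ^ 2 := by gcongr
    have h6 : δ ^ 2 ≤ ‖V x‖ ^ 2 := by gcongr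
    linarith
  set d : EuclideanSpace ℝ (Fin m) → ℝ := fun x => ‖u x‖ ^ 2 + (1 - ‖x‖ ^ 2) ^ 2 with hd
  have hdc : ContDiff ℝ 1 d :=
    (huc.norm_sq ℝ).add ((contDiff_const.sub (contDiff_id.norm_sq ℝ)).pow 2)
  have hdpos : ∀ x, 0 < d x := by
    intro x
    by_cases hx : x ∈ sphere (0 : EuclideanSpace ℝ (Fin m)) 1
    · have := norm_pos_iff.mpr (hu0 x hx)
      simp only [hd]
      positivity
    · have : (1 - ‖x‖ ^ 2) ≠ 0 := by
        intro h
        apply hx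
        have : ‖x‖ ^ 2 = 1 := by linarith
        rw [mem_sphere_zero_iff_norm]
        exact (pow_eq_one_iff_of_nonneg (norm_nonneg _) two_ne_zero).mp this
      simp only [hd]
      positivity
  apply hairy_smooth hm (fun x => (√(d x))⁻¹ • u x)
  · refine ContDiff.smul (ContDiff.inv (hdc.sqrt fun x => (hdpos x).ne') ?_) huc
    intro x
    exact (Real.sqrt_pos.mpr (hdpos x)).ne'
  · intro x hx
    rw [inner_smul_right, hu]
    simp only [inner_sub_right, inner_smul_right, real_inner_self_eq_norm_sq, hx]
    ring
  · intro x hx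
    have hdx : d x = ‖u x‖ ^ 2 := by simp [hd, hx]
    rw [hdx, Real.sqrt_sq (norm_nonneg _), norm_smul, norm_inv, norm_norm, inv_mul_cancel₀]
    exact norm_ne_zero_iff.mpr (hu0 x (by simpa using hx))

end HB


namespace CK
open MeasureTheory Set Pointwise Topology

section
variable {G : Type*} [Group G] [TopologicalSpace G] [IsTopologicalGroup G]

lemma exists_compact_cover [LocallyCompactSpace G] (H Γ : Subgroup G)
    (hc : CompactSpace (Quotient (MulAction.orbitRel Γ (G ⧸ H)))) :
    ∃ C : Set G, IsCompact C ∧ ∀ g : G, ∃ γ ∈ Γ, ∃ c ∈ C, ∃ h ∈ H, g = γ * c * h := by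
  let q : G → Quotient (MulAction.orbitRel Γ (G ⧸ H)) :=
    fun g => Quotient.mk _ (QuotientGroup.mk g : G ⧸ H)
  have : ContinuousConstSMul Γ (G ⧸ H) :=
    ⟨fun γ => (continuous_const_smul (γ : G) : Continuous fun x : G ⧸ H => (γ : G) • x)⟩
  have hq : IsOpenMap q :=
    (isOpenMap_quotient_mk'_mul (Γ := Γ) (T := G ⧸ H)).comp QuotientGroup.isOpenMap_coe
  have hqs : Function.Surjective q := by
    intro x
    obtain ⟨y, rfl⟩ := Quotient.exists_rep x
    obtain ⟨g, rfl⟩ := QuotientGroup.mk_surjective y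
    exact ⟨g, rfl⟩
  choose N hN hN1 using fun g : G => exists_compact_mem_nhds g
  obtain ⟨T, hT⟩ := isCompact_univ.elim_finite_subcover (fun g : G => q '' interior (N g))
    (fun g => hq _ isOpen_interior) (by
      intro x _
      obtain ⟨g, rfl⟩ := hqs x
      exact mem_iUnion.mpr ⟨g, g, mem_interior_iff_mem_nhds.mpr (hN1 g), rfl⟩)
  refine ⟨⋃ g ∈ T, N g, T.isCompact_biUnion fun g _ => hN g, ?_⟩
  intro g
  have := hT (mem_univ (q g))
  simp only [mem_iUnion, mem_image] at this
  obtain ⟨g0, hg0, c, hc, hcg⟩ := this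
  have h1 := Quotient.exact hcg
  change (MulAction.orbitRel Γ (G ⧸ H)) _ _ at h1
  rw [MulAction.orbitRel_apply, MulAction.mem_orbit_iff] at h1
  obtain ⟨γ, hγ⟩ := h1
  have h2 : ((γ : G) * g : G ⧸ H) = (c : G ⧸ H) := hγ
  have h3 : (QuotientGroup.mk ((γ : G) * g) : G ⧸ H) = QuotientGroup.mk c := hγ
  rw [QuotientGroup.eq] at h3
  refine ⟨(γ : G)⁻¹, Γ.inv_mem γ.2, c, ?_, _, H.inv_mem h3, ?_⟩
  · simp only [mem_iUnion]
    exact ⟨g0, hg0, interior_subset hc⟩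
  · group

lemma finite_return (H Γ : Subgroup G) (hp : ProperlyDiscontinuousSMul Γ (G ⧸ H))
    (C₁ C₂ : Set G) (h₁ : IsCompact C₁) (h₂ : IsCompact C₂) :
    {γ : Γ | ∃ c ∈ C₁, ∃ h ∈ H, (γ : G) * c * h ∈ C₂}.Finite := by
  have := hp.finite_disjoint_inter_image (K := (QuotientGroup.mk : G → G ⧸ H) '' C₁)
    (L := (QuotientGroup.mk : G → G ⧸ H) '' C₂)
    (h₁.image continuous_quotient_mk') (h₂.image continuous_quotient_mk')
  refine this.subset ?_
  rintro γ ⟨c, hc, h, hh, hm⟩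
  refine ⟨QuotientGroup.mk ((γ : G) * c * h), ?_, mem_image_of_mem _ hm⟩
  refine ⟨QuotientGroup.mk c, mem_image_of_mem _ hc, ?_⟩
  change (QuotientGroup.mk ((γ : G) * c) : G ⧸ H) = _
  rw [QuotientGroup.eq]
  have e : ((γ : G) * c)⁻¹ * ((γ : G) * c * h) = h := by group
  rw [e]
  exact hh

end

section
variable {G L : Type*} [Group G] [TopologicalSpace G] [IsTopologicalGroup G]
  [LocallyCompactSpace G] [T2Space G]
  [Group L] [TopologicalSpace L] [IsTopologicalGroup L] [LocallyCompactSpace L]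
  [MeasurableSpace L] [BorelSpace L]

lemma psi_continuous (φ : L →* G) (hφ : Continuous φ)
    (hproper : ∀ C, IsCompact C → IsCompact (φ ⁻¹' C)) (ρ : G → ℝ) (hρ : Continuous ρ)
    (hρc : HasCompactSupport ρ) (a : L → ℝ) (ha : Continuous a) :
    Continuous fun g => ∫ h, ρ (g * φ h) * a h ∂(Measure.haar : Measure L) := by
  rw [continuous_iff_continuousAt]
  intro g0
  obtain ⟨N, hN, hN1⟩ := exists_compact_mem_nhds g0
  refine ContinuousOn.continuousAt ?_ hN1
  refine continuousOn_integral_of_compact_support (k := φ ⁻¹' (N⁻¹ * tsupport ρ))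
    (hproper _ (hN.inv.mul hρc)) ?_ ?_
  · apply Continuous.continuousOn
    fun_prop
  · intro p h hp hh
    have : ρ (p * φ h) = 0 := by
      apply image_eq_zero_of_notMem_tsupport
      intro hmem
      exact hh ⟨p⁻¹, inv_mem_inv.mpr hp, _, hmem, by simp⟩
    rw [this, zero_mul]

lemma psi_integrable (φ : L →* G) (hφ : Continuous φ)
    (hproper : ∀ C, IsCompact C → IsCompact (φ ⁻¹' C)) (ρ : G → ℝ) (hρ : Continuous ρ)
    (hρc : HasCompactSupport ρ) (a : L → ℝ) (ha : Continuous a) (g : G) :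
    Integrable (fun h => ρ (g * φ h) * a h) (Measure.haar : Measure L) := by
  apply Continuous.integrable_of_hasCompactSupport
  · fun_prop
  · apply HasCompactSupport.mul_right
    refine HasCompactSupport.of_support_subset_isCompact
      (hproper ({g⁻¹} * tsupport ρ) (isCompact_singleton.mul hρc)) ?_
    intro h hh
    exact ⟨g⁻¹, rfl, _, subset_tsupport _ hh, by simp⟩

theorem averaging [T2Space L] (φ : L →* G) (hφ : Continuous φ)
    (hproper : ∀ C, IsCompact C → IsCompact (φ ⁻¹' C))
    {m : ℕ} (R : L →* Matrix (Fin m) (Fin m) ℝ) (hR : Continuous R) (l : Fin m)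
    (hR1 : ∀ h, 1 ≤ R h l l)
    (hRb : ∀ M : ℝ, ∃ Q : Set L, IsCompact Q ∧ ∀ h, (∀ i, |R h i l| ≤ M) → h ∈ Q)
    (Γ : Subgroup G) (hp : ProperlyDiscontinuousSMul Γ (G ⧸ φ.range))
    (hc : CompactSpace (Quotient (MulAction.orbitRel Γ (G ⧸ φ.range)))) :
    ∃ F : G → Fin m → ℝ, Continuous F ∧ (∀ g h, R h *ᵥ F (g * φ h) = F g) ∧
      ∃ C' : Set G, IsCompact C' ∧ ∀ g, (∀ i, i ≠ l → F g i = 0) →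
        ∃ γ ∈ Γ, ∃ c ∈ C', g = γ * c := by
  obtain ⟨C, hC, hcov⟩ := exists_compact_cover φ.range Γ hc
  obtain ⟨ρ, hρ1, -, hρc, hρ01⟩ := exists_continuous_one_zero_of_isCompact hC isClosed_empty
    (disjoint_empty C)
  have hρ0 : ∀ g, 0 ≤ ρ g := fun g => (hρ01 g).1
  have hRij : ∀ i, Continuous fun h => R h i l := fun i => hR.matrix_elem i l
  let μ : Measure L := Measure.haar
  let ψ : G → Fin m → ℝ := fun g i => ∫ h, ρ (g * φ h) * R h i l ∂μ
  let ν : G → ℝ := fun g => ∫ h, ρ (g * φ h) * 1 ∂μ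
  have hψc : ∀ i, Continuous fun g => ψ g i := fun i =>
    psi_continuous φ hφ hproper ρ ρ.continuous hρc _ (hRij i)
  have hνc : Continuous ν := psi_continuous φ hφ hproper ρ ρ.continuous hρc _ continuous_const
  have hψi := fun i g => psi_integrable φ hφ hproper ρ ρ.continuous hρc _ (hRij i) g
  have hνi := fun g => psi_integrable φ hφ hproper ρ ρ.continuous hρc _
    (continuous_const (y := (1:ℝ))) g
  have hψl : ∀ g, ν g ≤ ψ g l := by
    intro g
    apply integral_mono (hνi g) (hψi l g)
    intro h
    exact mul_le_mul_of_nonneg_left (hR1 h) (hρ0 _)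
  have hν0 : ∀ g, 0 ≤ ν g := fun g => integral_nonneg fun h => mul_nonneg (hρ0 _) zero_le_one
  have hνinv : ∀ g h', ν (g * φ h') = ν g := by
    intro g h'
    simp only [ν]
    rw [← integral_mul_left_eq_self (fun h => ρ (g * φ h) * 1) h']
    simp only [map_mul, mul_assoc]
  have hψinv : ∀ g h' , R h' *ᵥ ψ (g * φ h') = ψ g := by
    intro g h'
    ext i
    simp only [Matrix.mulVec, dotProduct, ψ]
    rw [← integral_mul_left_eq_self (fun h => ρ (g * φ h) * R h i l) h']
    simp only [← integral_const_mul]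
    rw [← integral_finsetSum]
    · congr 1
      ext h
      rw [map_mul φ, map_mul R, Matrix.mul_apply, Finset.mul_sum]
      refine Finset.sum_congr rfl fun j _ => ?_
      rw [mul_assoc g]; ring
    · intro j _
      exact (hψi j _).const_mul _
  have hνpos : ∀ c ∈ C, 0 < ν c := by
    intro c hcC
    apply Continuous.integral_pos_of_hasCompactSupport_nonneg_nonzero (x := (1 : L))
    · fun_prop
    · apply HasCompactSupport.mul_right
      refine HasCompactSupport.of_support_subset_isCompact
        (hproper ({c⁻¹} * tsupport ρ) (isCompact_singleton.mul hρc)) ?_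
      intro h hh
      exact ⟨c⁻¹, rfl, _, subset_tsupport _ hh, by simp⟩
    · intro h; exact mul_nonneg (hρ0 _) zero_le_one
    · have := hρ1 hcC
      simp only [map_one, mul_one]
      rw [this]; simp
  have hψ0 : ∀ g, (∀ h, g * φ h ∉ tsupport ρ) → ψ g = 0 := by
    intro g hg
    ext i
    simp only [ψ]
    have : ∀ h, ρ (g * φ h) * R h i l = 0 := fun h => by
      rw [image_eq_zero_of_notMem_tsupport (hg h), zero_mul]
    simp [this]
  -- finiteness
  have hfin : ∀ N : Set G, IsCompact N → ∃ T : Finset Γ, ∀ γ : Γ, γ ∉ T → ∀ g ∈ N, ∀ h : L,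
      ψ ((γ : G) * (g * φ h)) = 0 := by
    intro N hN
    have := finite_return φ.range Γ hp N (tsupport ρ) hN hρc
    refine ⟨this.toFinset, ?_⟩
    intro γ hγ g hg h
    apply hψ0
    intro h' hmem
    apply hγ
    rw [Set.Finite.mem_toFinset]
    exact ⟨g, hg, φ (h * h'), ⟨_, rfl⟩, by rw [map_mul]; simpa only [mul_assoc] using hmem⟩
  let F : G → Fin m → ℝ := fun g i => ∑ᶠ γ : Γ, ψ ((γ : G) * g) i
  have hFsum : ∀ (T : Finset Γ) (g : G), (∀ γ : Γ, γ ∉ T → ψ ((γ : G) * g) = 0) →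
      ∀ i, F g i = ∑ γ ∈ T, ψ ((γ : G) * g) i := by
    intro T g h i
    apply finsum_eq_sum_of_support_subset
    intro γ hγ
    by_contra hγT
    exact hγ (congrFun (h γ hγT) i)
  have hFc : Continuous F := by
    rw [continuous_iff_continuousAt]
    intro g0
    obtain ⟨N, hN, hN1⟩ := exists_compact_mem_nhds g0
    refine ContinuousOn.continuousAt ?_ hN1
    obtain ⟨T, hT⟩ := hfin N hN
    have : ContinuousOn (fun g i => ∑ γ ∈ T, ψ ((γ : G) * g) i) N := by
      apply Continuous.continuousOn
      apply continuous_pi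
      intro i
      apply continuous_finsetSum
      intro γ _
      exact (hψc i).comp (continuous_const.mul continuous_id)
    refine this.congr ?_
    intro g hg
    ext i
    exact hFsum T g (fun γ hγ => by simpa using hT γ hγ g hg 1) i
  have hFinv : ∀ γ ∈ Γ, ∀ g, F (γ * g) = F g := by
    intro γ hγ g
    ext i
    simp only [F]
    rw [← finsum_comp_equiv (Equiv.mulRight (⟨γ, hγ⟩ : Γ)) (f := fun γ' : Γ => ψ ((γ' : G) * g) i)]
    simp [mul_assoc]
  have hFR : ∀ g h, R h *ᵥ F (g * φ h) = F g := by
    intro g h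
    obtain ⟨T, hT⟩ := hfin {g} isCompact_singleton
    have e1 := hFsum T g (fun γ hγ => by simpa using hT γ hγ g rfl 1)
    have e2 := hFsum T (g * φ h) (fun γ hγ => hT γ hγ g rfl h)
    ext i
    rw [e1]
    simp only [Matrix.mulVec, dotProduct, e2, Finset.mul_sum]
    rw [Finset.sum_comm]
    refine Finset.sum_congr rfl fun γ _ => ?_
    have := congrFun (hψinv ((γ : G) * g) h) i
    rw [← this]
    simp only [Matrix.mulVec, dotProduct, mul_assoc]
  refine ⟨F, hFc, hFR, ?_⟩
  rcases C.eq_empty_or_nonempty with hCe | hCne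
  · refine ⟨∅, isCompact_empty, ?_⟩
    intro g _
    obtain ⟨γ, _, c, hcC, _⟩ := hcov g
    rw [hCe] at hcC
    exact absurd hcC (notMem_empty c)
  obtain ⟨c0, hc0, hmin⟩ := hC.exists_isMinOn hCne hνc.continuousOn
  have hm0 := hνpos c0 hc0
  obtain ⟨M, hM⟩ := hC.exists_bound_of_continuousOn hFc.continuousOn
  obtain ⟨Q, hQ, hQb⟩ := hRb (M / ν c0)
  refine ⟨C * φ '' Q, hC.mul (hQ.image hφ), ?_⟩
  intro g hg
  obtain ⟨γ, hγ, c, hcC, _, ⟨h, rfl⟩, rfl⟩ := hcov g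
  refine ⟨γ, hγ, c * φ h, mul_mem_mul hcC (mem_image_of_mem _ ?_), mul_assoc _ _ _⟩
  apply hQb
  intro i
  rw [mul_assoc, hFinv γ hγ] at hg
  have e1 : F c i = R h i l * F (c * φ h) l := by
    rw [← hFR c h]
    simp only [Matrix.mulVec, dotProduct]
    rw [Finset.sum_eq_single l]
    · intro j _ hj
      rw [hg j hj, mul_zero]
    · simp
  have e2 : ν c0 ≤ F (c * φ h) l := by
    classical
    obtain ⟨T, hT⟩ := hfin {c} isCompact_singleton
    have e2 := hFsum (insert 1 T) (c * φ h) (fun γ hγ => hT γ (fun h => hγ (Finset.mem_insert_of_mem h)) c rfl h) l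
    rw [e2]
    calc ν c0 ≤ ν c := hmin hcC
      _ = ν (c * φ h) := (hνinv _ _).symm
      _ ≤ ψ (c * φ h) l := hψl _
      _ = ψ (((1 : Γ) : G) * (c * φ h)) l := by simp
      _ ≤ _ := Finset.single_le_sum (f := fun γ : Γ => ψ ((γ : G) * (c * φ h)) l)
        (fun γ _ => (hν0 _).trans (hψl _)) (Finset.mem_insert_self _ _)
  have e3 : |F c i| ≤ M := (norm_le_pi_norm (F c) i).trans (hM c hcC)
  rw [le_div_iff₀ hm0]
  rw [e1, abs_mul] at e3
  refine le_trans ?_ e3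
  gcongr
  exact e2.trans (le_abs_self _)

open Metric in
theorem zero_on_orbit [T2Space L] (φ : L →* G)
    {m : ℕ} (hm : Odd m) (R : L →* Matrix (Fin m) (Fin m) ℝ) (l : Fin m)
    (k : sphere (0 : EuclideanSpace ℝ (Fin m)) 1 → G) (hk : Continuous k)
    (rot : sphere (0 : EuclideanSpace ℝ (Fin m)) 1 → Matrix (Fin m) (Fin m) ℝ)
    (hrot : Continuous rot) (horth : ∀ u, (rot u)ᵀ * rot u = 1)
    (hsurj : ∀ x : EuclideanSpace ℝ (Fin m), ‖x‖ = 1 →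
      ∃ u, rot u *ᵥ Pi.single l 1 = (x : Fin m → ℝ))
    (hfib : ∀ u₁ u₂, rot u₁ *ᵥ Pi.single l 1 = rot u₂ *ᵥ Pi.single l 1 →
      ∃ h, k u₂ = k u₁ * φ h ∧ rot u₂ = rot u₁ * R h ∧
        ∀ i, i ≠ l → R h i l = 0 ∧ R h l i = 0)
    (F : G → Fin m → ℝ) (hF : Continuous F) (hFR : ∀ g h, R h *ᵥ F (g * φ h) = F g) (g : G) :
    ∃ u, ∀ i, i ≠ l → F (g * k u) i = 0 := by
  let S := sphere (0 : EuclideanSpace ℝ (Fin m)) 1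
  let z : (Fin m → ℝ) → (Fin m → ℝ) := fun w i => if i = l then 0 else w i
  have hz : Continuous z := by
    apply continuous_pi
    intro i
    by_cases h : i = l
    · simp only [z, h, if_true]; exact continuous_const
    · simp only [z, h, if_false]; exact continuous_apply i
  let Φ : S → EuclideanSpace ℝ (Fin m) := fun u => WithLp.toLp 2 (rot u *ᵥ z (F (g * k u)))
  have hΦ : Continuous Φ := by
    apply (PiLp.continuous_toLp 2 _).comp
    exact hrot.matrix_mulVec (hz.comp (hF.comp (continuous_const.mul hk)))
  have hdot : ∀ u (v w : Fin m → ℝ), (rot u *ᵥ v) ⬝ᵥ (rot u *ᵥ w) = v ⬝ᵥ w := by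
    intro u v w
    rw [Matrix.dotProduct_mulVec, Matrix.vecMul_mulVec, ← Matrix.dotProduct_mulVec,
      horth, Matrix.one_mulVec]
  have hqm : ∀ u : S, ‖(WithLp.toLp 2 (rot u *ᵥ Pi.single l 1) : EuclideanSpace ℝ (Fin m))‖ = 1 := by
    intro u
    have : ‖(WithLp.toLp 2 (rot u *ᵥ Pi.single l 1) : EuclideanSpace ℝ (Fin m))‖ ^ 2 = 1 := by
      rw [EuclideanSpace.real_norm_sq_eq]
      have := hdot u (Pi.single l 1) (Pi.single l 1)
      simp only [dotProduct_single, Pi.single_eq_same, mul_one] at this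
      refine Eq.trans ?_ this
      simp only [sq]; rfl
    exact (pow_eq_one_iff_of_nonneg (norm_nonneg _) two_ne_zero).mp this
  let q : S → S := fun u => ⟨WithLp.toLp 2 (rot u *ᵥ Pi.single l 1), by
    rw [mem_sphere_zero_iff_norm]; exact hqm u⟩
  have hq : Continuous q := by
    refine Continuous.subtype_mk ?_ _
    apply (PiLp.continuous_toLp 2 _).comp
    exact hrot.matrix_mulVec continuous_const
  have hqs : Function.Surjective q := by
    intro x
    obtain ⟨u, hu⟩ := hsurj x.1 (by simpa using x.2)
    refine ⟨u, ?_⟩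
    apply Subtype.ext
    simp only [q]
    rw [hu]
  have : CompactSpace S := isCompact_iff_compactSpace.mp (isCompact_sphere _ _)
  have hqq : IsQuotientMap q := hq.isClosedMap.isQuotientMap hq hqs
  have hΦq : ∀ u₁ u₂, q u₁ = q u₂ → Φ u₁ = Φ u₂ := by
    intro u₁ u₂ h
    have h1 : rot u₁ *ᵥ Pi.single l 1 = rot u₂ *ᵥ Pi.single l 1 := by
      have := congrArg Subtype.val h
      simpa [q] using this
    obtain ⟨h, hk2, hr2, hb⟩ := hfib u₁ u₂ h1
    have e1 := hFR (g * k u₁) h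
    rw [mul_assoc, ← hk2] at e1
    simp only [Φ]
    rw [← e1, hr2, ← Matrix.mulVec_mulVec]
    congr 2
    ext i
    simp only [z, Matrix.mulVec, dotProduct]
    split_ifs with hi
    · subst hi
      rw [eq_comm]
      apply Finset.sum_eq_zero
      intro j _
      split_ifs with hj
      · simp
      · rw [(hb j hj).2, zero_mul]
    · refine Finset.sum_congr rfl fun j _ => ?_
      split_ifs with hj
      · subst hj; rw [(hb i hi).1]; simp
      · rfl
  classical
  let V : EuclideanSpace ℝ (Fin m) → EuclideanSpace ℝ (Fin m) :=
    fun x => if hx : x ∈ S then Φ (Function.surjInv hqs ⟨x, hx⟩) else 0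
  have hVq : ∀ u, V (q u) = Φ u := by
    intro u
    simp only [V]
    rw [dif_pos (q u).2]
    exact hΦq _ _ (Function.surjInv_eq hqs _)
  have hVc : ContinuousOn V S := by
    rw [continuousOn_iff_continuous_domRestrict, hqq.continuous_iff]
    refine hΦ.congr ?_
    intro u
    exact (hVq u).symm
  obtain ⟨x, hx, hx0⟩ := HB.hairy_ball hm V hVc (by
    intro x hx
    obtain ⟨u, hu⟩ := hqs ⟨x, hx⟩
    have hxu : x = q u := by rw [hu]
    rw [hxu, hVq]
    have := hdot u (z (F (g * k u))) (Pi.single l 1)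
    simp only [dotProduct_single, mul_one] at this
    rw [EuclideanSpace.inner_eq_star_dotProduct]
    simp only [q, Φ, star_trivial]
    rw [this]
    simp [z])
  obtain ⟨u, hu⟩ := hqs ⟨x, hx⟩
  have hxu : x = q u := by rw [hu]
  rw [hxu, hVq] at hx0
  refine ⟨u, ?_⟩
  have h1 : rot u *ᵥ z (F (g * k u)) = 0 := by
    have := congrArg WithLp.ofLp hx0
    simpa [Φ] using this
  have h2 : z (F (g * k u)) = 0 := by
    rw [← Matrix.one_mulVec (z _), ← horth u, ← Matrix.mulVec_mulVec, h1, Matrix.mulVec_zero]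
  intro i hi
  have := congrFun h2 i
  simpa [z, hi] using this

open Metric in
theorem no_form [T2Space L] (φ : L →* G) (hφ : Continuous φ)
    (hproper : ∀ C, IsCompact C → IsCompact (φ ⁻¹' C))
    {m : ℕ} (hm : Odd m) (R : L →* Matrix (Fin m) (Fin m) ℝ) (hR : Continuous R) (l : Fin m)
    (hR1 : ∀ h, 1 ≤ R h l l)
    (hRb : ∀ M : ℝ, ∃ Q : Set L, IsCompact Q ∧ ∀ h, (∀ i, |R h i l| ≤ M) → h ∈ Q)
    (hRu : ∀ M : ℝ, ∃ h, M < R h l l)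
    (k : sphere (0 : EuclideanSpace ℝ (Fin m)) 1 → G) (hk : Continuous k)
    (rot : sphere (0 : EuclideanSpace ℝ (Fin m)) 1 → Matrix (Fin m) (Fin m) ℝ)
    (hrot : Continuous rot) (horth : ∀ u, (rot u)ᵀ * rot u = 1)
    (hsurj : ∀ x : EuclideanSpace ℝ (Fin m), ‖x‖ = 1 →
      ∃ u, rot u *ᵥ Pi.single l 1 = (x : Fin m → ℝ))
    (hfib : ∀ u₁ u₂, rot u₁ *ᵥ Pi.single l 1 = rot u₂ *ᵥ Pi.single l 1 →
      ∃ h, k u₂ = k u₁ * φ h ∧ rot u₂ = rot u₁ * R h ∧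
        ∀ i, i ≠ l → R h i l = 0 ∧ R h l i = 0)
    (Γ : Subgroup G) (hp : ProperlyDiscontinuousSMul Γ (G ⧸ φ.range))
    (hc : CompactSpace (Quotient (MulAction.orbitRel Γ (G ⧸ φ.range)))) : False := by
  obtain ⟨F, hF, hFR, C', hC', hF0⟩ := averaging φ hφ hproper R hR l hR1 hRb Γ hp hc
  have : CompactSpace (sphere (0 : EuclideanSpace ℝ (Fin m)) 1) :=
    isCompact_iff_compactSpace.mp (isCompact_sphere _ _)
  set C := C' * (range k)⁻¹ with hCdef
  have hC : IsCompact C := hC'.mul (isCompact_range hk).inv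
  have hcov : ∀ g, ∃ γ ∈ Γ, ∃ c ∈ C, g = γ * c := by
    intro g
    obtain ⟨u, hu⟩ := zero_on_orbit φ hm R l k hk rot hrot horth hsurj hfib F hF hFR g
    obtain ⟨γ, hγ, c, hcc, e⟩ := hF0 _ hu
    refine ⟨γ, hγ, c * (k u)⁻¹, mul_mem_mul hcc (inv_mem_inv.mpr (mem_range_self u)), ?_⟩
    rw [← mul_assoc, ← e]; group
  have hfin := finite_return φ.range Γ hp C {1} hC isCompact_singleton
  have hcomp : IsCompact (⋃ γ ∈ {γ : Γ | ∃ c ∈ C, ∃ h ∈ φ.range, (γ : G) * c * h ∈ ({1} : Set G)},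
      ({(γ : G)} * C : Set G)) :=
    hfin.isCompact_biUnion fun γ _ => isCompact_singleton.mul hC
  have huniv : IsCompact (univ : Set L) := by
    refine (hproper _ hcomp).of_isClosed_subset isClosed_univ ?_
    intro h _
    obtain ⟨γ, hγ, c, hcC, e⟩ := hcov (φ h)
    simp only [mem_preimage, mem_iUnion]
    refine ⟨⟨γ, hγ⟩, ⟨c, hcC, φ h⁻¹, ⟨_, rfl⟩, ?_⟩, γ, rfl, c, hcC, e.symm⟩
    simp only [← e, map_inv, mul_inv_cancel, mem_singleton_iff]
  obtain ⟨M, hM⟩ := huniv.exists_bound_of_continuousOn (hR.matrix_elem l l).continuousOn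
  obtain ⟨h, hh⟩ := hRu M
  have := hM h (mem_univ h)
  rw [Real.norm_eq_abs] at this
  linarith [le_abs_self (R h l l)]

end
end CK

namespace DD
open Topology

section
variable {ι : Type*} [Fintype ι] [DecidableEq ι]

/-- Reflection in the vector `v` with respect to the form `J`. -/
def rf (J : Matrix ι ι ℝ) (v : ι → ℝ) : Matrix ι ι ℝ :=
  1 - (2 : ℝ) • vecMulVec v (J *ᵥ v)

lemma rf_pres (J : Matrix ι ι ℝ) (hJ : Jᵀ = J) (v : ι → ℝ) (hv : v ⬝ᵥ J *ᵥ v = 1) :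
    (rf J v)ᵀ * J * rf J v = J := by
  have e1 : v ᵥ* J = J *ᵥ v := by rw [← Matrix.mulVec_transpose, hJ]
  have e2 : (J *ᵥ v) ⬝ᵥ v = 1 := by rw [dotProduct_comm]; exact hv
  have f1 : vecMulVec (J *ᵥ v) v * J = vecMulVec (J *ᵥ v) (J *ᵥ v) := by
    rw [vecMulVec_mul, e1]
  have f2 : J * vecMulVec v (J *ᵥ v) = vecMulVec (J *ᵥ v) (J *ᵥ v) := by
    rw [mul_vecMulVec]
  unfold rf
  rw [transpose_sub, transpose_smul, transpose_vecMulVec, transpose_one]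
  simp only [sub_mul, mul_sub, one_mul, mul_one, Matrix.smul_mul, Matrix.mul_smul,
    f1, f2, vecMulVec_mul_vecMulVec, e2]
  simp only [one_smul]
  module

lemma rf_sq (J : Matrix ι ι ℝ) (v : ι → ℝ) (hv : v ⬝ᵥ J *ᵥ v = 1) :
    rf J v * rf J v = 1 := by
  have e2 : (J *ᵥ v) ⬝ᵥ v = 1 := by rw [dotProduct_comm]; exact hv
  unfold rf
  simp only [sub_mul, mul_sub, one_mul, mul_one, Matrix.smul_mul, Matrix.mul_smul,
    vecMulVec_mul_vecMulVec, e2]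
  simp only [one_smul]
  module

lemma rf_transpose_one (v : ι → ℝ) : (rf 1 v)ᵀ = rf 1 v := by
  unfold rf
  rw [transpose_sub, transpose_smul, transpose_vecMulVec, transpose_one, one_mulVec]

lemma rf_det (v : ι → ℝ) (hv : v ⬝ᵥ v = 1) : (rf 1 v).det = -1 := by
  have := det_one_add_replicateCol_mul_replicateRow (ι := Unit) ((-2 : ℝ) • v) v
  rw [dotProduct_smul, hv] at this
  have e : rf 1 v = 1 + replicateCol Unit ((-2 : ℝ) • v) * replicateRow Unit v := by
    ext i j
    simp [rf, Matrix.mul_apply, vecMulVec_apply]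
    ring
  rw [e, this]; norm_num

lemma rf_continuous {X : Type*} [TopologicalSpace X] (J : Matrix ι ι ℝ) (v : X → ι → ℝ)
    (hv : Continuous v) : Continuous fun x => rf J (v x) := by
  unfold rf
  have : Continuous fun x => vecMulVec (v x) (J *ᵥ v x) := hv.matrix_vecMulVec (continuous_const.matrix_mulVec hv)
  exact continuous_const.sub (this.const_smul (2 : ℝ))

lemma isEmbedding_unitsVal (𝕜 : Type*) [Field 𝕜] [TopologicalSpace 𝕜] [IsTopologicalRing 𝕜]
    [ContinuousInv₀ 𝕜] :
    IsEmbedding (Units.val : (Matrix ι ι 𝕜)ˣ → Matrix ι ι 𝕜) := by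
  refine Units.isEmbedding_val_mk' (f := fun A => A.det⁻¹ • A.adjugate) ?_ ?_
  · intro A hA
    have : A.det ≠ 0 := ((Matrix.isUnit_iff_isUnit_det A).mp hA).ne_zero
    apply ContinuousAt.continuousWithinAt
    refine ContinuousAt.smul (ContinuousAt.inv₀ ?_ this) ?_
    · exact (Continuous.matrix_det continuous_id).continuousAt
    · exact (Continuous.matrix_adjugate continuous_id).continuousAt
  · intro u
    rw [Matrix.coe_units_inv, Matrix.inv_def, Ring.inverse_eq_inv']

end

section
variable (n : ℕ)

abbrev J : Matrix (Fin (2 * n + 1)) (Fin (2 * n + 1)) ℝ := formMat (2 * n) 1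

lemma lt_iff (i : Fin (2 * n + 1)) : (i : ℕ) < 2 * n ↔ i ≠ Fin.last (2 * n) := by
  rw [Ne, Fin.ext_iff, Fin.val_last]; have := i.2; omega

lemma J_eq : J n = diagonal fun i => if i ≠ Fin.last (2 * n) then (1 : ℝ) else -1 := by
  unfold J formMat
  congr 1
  ext i
  simp only [lt_iff]

lemma J_tr : (J n)ᵀ = J n := by simp [J, formMat]

lemma J_sq : J n * J n = 1 := by
  rw [J_eq, diagonal_mul_diagonal, ← diagonal_one]
  congr 1; ext i; split_ifs <;> simp

/-- Elements of `O(2n,1)` from matrices. -/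
def mkO (A : Matrix (Fin (2 * n + 1)) (Fin (2 * n + 1)) ℝ) (hA : Aᵀ * J n * A = J n) :
    indefO (2 * n) 1 :=
  have h : J n * Aᵀ * J n * A = 1 := by
    rw [mul_assoc, mul_assoc, ← mul_assoc Aᵀ, hA, J_sq]
  ⟨⟨A, J n * Aᵀ * J n, mul_eq_one_comm.mp h, h⟩, hA⟩

lemma isEmbedding_O : IsEmbedding (fun A : indefO (2 * n) 1 =>
    ((A : GL (Fin (2 * n + 1)) ℝ) : Matrix (Fin (2 * n + 1)) (Fin (2 * n + 1)) ℝ)) :=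
  (isEmbedding_unitsVal ℝ).comp IsEmbedding.subtypeVal

lemma isClosedEmbedding_O : IsClosedEmbedding (fun A : indefO (2 * n) 1 =>
    ((A : GL (Fin (2 * n + 1)) ℝ) : Matrix (Fin (2 * n + 1)) (Fin (2 * n + 1)) ℝ)) := by
  refine ⟨isEmbedding_O n, ?_⟩
  have : Set.range (fun A : indefO (2 * n) 1 =>
    ((A : GL (Fin (2 * n + 1)) ℝ) : Matrix (Fin (2 * n + 1)) (Fin (2 * n + 1)) ℝ)) =
      {A | Aᵀ * J n * A = J n} := by
    ext A
    constructor
    · rintro ⟨B, rfl⟩; exact B.2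
    · intro hA; exact ⟨mkO n A hA, rfl⟩
  rw [this]
  exact isClosed_eq (by fun_prop) continuous_const

/-- The identity component. -/
abbrev L := Subgroup.connectedComponentOfOne (indefO (2 * n) 1)

/-- The defining representation. -/
def R : L n →* Matrix (Fin (2 * n + 1)) (Fin (2 * n + 1)) ℝ :=
  (Units.coeHom _).comp ((indefO (2 * n) 1).subtype.comp (L n).subtype)

lemma isClosed_L : IsClosed (L n : Set (indefO (2 * n) 1)) := isClosed_connectedComponent

lemma isClosedEmbedding_R : IsClosedEmbedding (R n) :=
  (isClosedEmbedding_O n).comp (isClosed_L n).isClosedEmbedding_subtypeVal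

instance : LocallyCompactSpace (L n) :=
  haveI : LocallyCompactSpace (Matrix (Fin (2 * n + 1)) (Fin (2 * n + 1)) ℝ) :=
    inferInstanceAs (LocallyCompactSpace (Fin (2 * n + 1) → Fin (2 * n + 1) → ℝ))
  (isClosedEmbedding_R n).locallyCompactSpace

instance : T2Space (L n) := inferInstance

/-- Elements of `SO(2n+1,ℂ)` from matrices. -/
def mkSO (A : Matrix (Fin (2 * n + 1)) (Fin (2 * n + 1)) ℂ) (hA : Aᵀ * A = 1) (hd : A.det = 1) :
    SOC (2 * n + 1) :=
  ⟨⟨A, Aᵀ, mul_eq_one_comm.mp hA, hA⟩, hA, hd⟩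

lemma isEmbedding_SO : IsEmbedding (fun A : SOC (2 * n + 1) =>
    ((A : GL (Fin (2 * n + 1)) ℂ) : Matrix (Fin (2 * n + 1)) (Fin (2 * n + 1)) ℂ)) :=
  (isEmbedding_unitsVal ℂ).comp IsEmbedding.subtypeVal

lemma isClosedEmbedding_SO : IsClosedEmbedding (fun A : SOC (2 * n + 1) =>
    ((A : GL (Fin (2 * n + 1)) ℂ) : Matrix (Fin (2 * n + 1)) (Fin (2 * n + 1)) ℂ)) := by
  refine ⟨isEmbedding_SO n, ?_⟩
  have : Set.range (fun A : SOC (2 * n + 1) =>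
    ((A : GL (Fin (2 * n + 1)) ℂ) : Matrix (Fin (2 * n + 1)) (Fin (2 * n + 1)) ℂ)) =
      {A | Aᵀ * A = 1} ∩ {A | A.det = 1} := by
    ext A
    constructor
    · rintro ⟨B, rfl⟩; exact B.2
    · intro hA; exact ⟨mkSO n A hA.1 hA.2, rfl⟩
  rw [this]
  exact (isClosed_eq (by fun_prop) continuous_const).inter
    (isClosed_eq (Continuous.matrix_det continuous_id) continuous_const)

instance : LocallyCompactSpace (SOC (2 * n + 1)) :=
  haveI : LocallyCompactSpace (Matrix (Fin (2 * n + 1)) (Fin (2 * n + 1)) ℂ) :=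
    inferInstanceAs (LocallyCompactSpace (Fin (2 * n + 1) → Fin (2 * n + 1) → ℂ))
  (isClosedEmbedding_SO n).locallyCompactSpace

instance : T2Space (SOC (2 * n + 1)) := inferInstance

/-- Products of reflections in a connected family lie in the identity component. -/
lemma mem_L {X : Type*} [TopologicalSpace X] [PreconnectedSpace X]
    (v : X → Fin (2 * n + 1) → ℝ) (hv : Continuous v) (hq : ∀ x, v x ⬝ᵥ J n *ᵥ v x = 1) (x y : X) :
    ∃ h : L n, R n h = rf (J n) (v x) * rf (J n) (v y) := by
  have hp : ∀ x, (rf (J n) (v x) * rf (J n) (v y))ᵀ * J n * (rf (J n) (v x) * rf (J n) (v y))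
      = J n := by
    intro x
    rw [transpose_mul]
    calc _ = (rf (J n) (v y))ᵀ * ((rf (J n) (v x))ᵀ * J n * rf (J n) (v x)) * rf (J n) (v y) := by
          simp only [mul_assoc]
      _ = _ := by rw [rf_pres _ (J_tr n) _ (hq x), rf_pres _ (J_tr n) _ (hq y)]
  let f : X → indefO (2 * n) 1 := fun x => mkO n _ (hp x)
  have hf : Continuous f := by
    rw [(isEmbedding_O n).continuous_iff]
    exact (rf_continuous _ _ hv).mul continuous_const
  have hy : f y = 1 := by
    apply (isEmbedding_O n).injective
    exact rf_sq _ _ (hq y)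
  have : f x ∈ connectedComponent (1 : indefO (2 * n) 1) :=
    (isPreconnected_range hf).subset_connectedComponent ⟨y, hy⟩ ⟨x, rfl⟩
  exact ⟨⟨f x, this⟩, rfl⟩

lemma R_pres (h : L n) : (R n h)ᵀ * J n * R n h = J n := h.1.2

lemma R_pres' (h : L n) : R n h * J n * (R n h)ᵀ = J n := by
  have h1 : J n * (R n h)ᵀ * J n * R n h = 1 := by
    rw [mul_assoc, mul_assoc, ← mul_assoc (R n h)ᵀ, R_pres, J_sq]
  have h2 := mul_eq_one_comm.mp h1
  calc R n h * J n * (R n h)ᵀ = R n h * (J n * (R n h)ᵀ * J n) * J n := by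
        simp only [mul_assoc, J_sq, mul_one]
    _ = _ := by rw [h2, one_mul]

lemma preconn_L : PreconnectedSpace (L n) :=
  Subtype.preconnectedSpace isPreconnected_connectedComponent

lemma quad_row (h : L n) (i : Fin (2 * n + 1)) :
    ∑ j, (R n h i j) ^ 2 = J n i i + 2 * (R n h i (Fin.last _)) ^ 2 := by
  have := congrFun (congrFun (R_pres' n h) i) i
  rw [J_eq, Matrix.mul_apply] at this
  simp only [mul_diagonal, transpose_apply] at this
  rw [J_eq, ← this]
  rw [← Finset.sum_erase_add _ _ (Finset.mem_univ (Fin.last (2 * n))),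
    ← Finset.sum_erase_add (a := Fin.last (2 * n)) Finset.univ _ (Finset.mem_univ (Fin.last (2 * n)))]
  rw [Finset.sum_congr rfl (g := fun x => R n h i x ^ 2) (s₁ := Finset.univ.erase (Fin.last (2 * n)))
    (f := fun x => (R n h i x * if x ≠ Fin.last (2 * n) then 1 else -1) * R n h i x)]
  · simp; ring
  · intro x hx
    simp [(Finset.mem_erase.mp hx).1]; ring

lemma one_le_R (h : L n) : 1 ≤ R n h (Fin.last _) (Fin.last _) := by
  have hsq : ∀ h : L n, 1 ≤ (R n h (Fin.last _) (Fin.last _)) ^ 2 := by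
    intro h
    have h1 := quad_row n h (Fin.last _)
    have h2 := Finset.single_le_sum (f := fun j => (R n h (Fin.last _) j) ^ 2)
      (fun _ _ => sq_nonneg _) (Finset.mem_univ (Fin.last (2 * n)))
    rw [h1] at h2
    rw [J_eq] at h2
    simp at h2
    nlinarith
  have := preconn_L n
  have hc : Continuous fun h : L n => R n h (Fin.last _) (Fin.last _) :=
    (isClosedEmbedding_R n).continuous.matrix_elem _ _
  by_contra hlt
  push Not at hlt
  have h0 : R n h (Fin.last _) (Fin.last _) ≤ 0 := by
    by_contra h0
    push Not at h0
    nlinarith [hsq h]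
  obtain ⟨g, hg⟩ := mem_range_of_exists_le_of_exists_ge hc ⟨h, h0⟩ ⟨1, by simp⟩
  have := hsq g
  simp only at hg
  rw [hg] at this
  norm_num at this

lemma det_R (h : L n) : (R n h).det = 1 := by
  have hsq : ∀ h : L n, (R n h).det ^ 2 = 1 := by
    intro h
    have h1 := congrArg det (R_pres n h)
    have h2 := congrArg det (J_sq n)
    rw [det_mul, det_mul, det_transpose] at h1
    rw [det_mul, det_one] at h2
    have : (J n).det ≠ 0 := by
      intro h0; rw [h0] at h2; norm_num at h2
    apply mul_right_cancel₀ this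
    rw [one_mul]; nlinarith
  have := preconn_L n
  have hc : Continuous fun h : L n => (R n h).det :=
    (isClosedEmbedding_R n).continuous.matrix_det
  by_contra hlt
  have h0 : (R n h).det ≤ 0 := by
    rcases sq_eq_sq_iff_eq_or_eq_neg.mp ((hsq h).trans (one_pow 2).symm) with h' | h' <;> first | exact absurd h' hlt | linarith
  obtain ⟨g, hg⟩ := mem_range_of_exists_le_of_exists_ge hc ⟨h, h0⟩ ⟨1, by simp⟩
  have := hsq g
  simp only at hg
  rw [hg] at this
  norm_num at this

lemma compact_of_bound (M : ℝ) :
    IsCompact {h : L n | ∀ i j, |R n h i j| ≤ M} := by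
  have h1 : IsCompact (Set.pi Set.univ fun _ : Fin (2 * n + 1) =>
      Set.pi Set.univ fun _ : Fin (2 * n + 1) => Set.Icc (-M) M) :=
    isCompact_univ_pi fun _ => isCompact_univ_pi fun _ => isCompact_Icc
  have h2 := (isClosedEmbedding_R n).isCompact_preimage (K := (Set.pi Set.univ
    fun _ : Fin (2 * n + 1) => Set.pi Set.univ fun _ : Fin (2 * n + 1) => Set.Icc (-M) M)) h1
  convert h2 using 1
  ext h
  change (∀ i j, |R n h i j| ≤ M) ↔ _
  simp only [abs_le]
  exact ⟨fun H i _ j _ => H i j, fun H i j => H i trivial j trivial⟩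

lemma R_bound (M : ℝ) : ∃ Q : Set (L n), IsCompact Q ∧
    ∀ h, (∀ i, |R n h i (Fin.last _)| ≤ M) → h ∈ Q := by
  refine ⟨_, compact_of_bound n (1 + 2 * M ^ 2), ?_⟩
  intro h hM i j
  have h1 := quad_row n h i
  have h2 := Finset.single_le_sum (f := fun j => (R n h i j) ^ 2)
      (fun _ _ => sq_nonneg _) (Finset.mem_univ j)
  have h3 : J n i i ≤ 1 := by rw [J_eq]; simp; split_ifs <;> norm_num
  have h4 : (R n h i (Fin.last _)) ^ 2 ≤ M ^ 2 := sq_le_sq' (by linarith [(abs_le.mp (hM i)).1])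
    (abs_le.mp (hM i)).2
  change (R n h i j) ^ 2 ≤ _ at h2
  apply abs_le_of_sq_le_sq _ (by positivity)
  nlinarith [sq_nonneg M, sq_nonneg (M ^ 2)]

end
end DD

namespace DD
open Topology Metric

section
variable {ι : Type*} [Fintype ι] [DecidableEq ι]

lemma rf_mulVec (J : Matrix ι ι ℝ) (v w : ι → ℝ) :
    rf J v *ᵥ w = w - (2 * ((J *ᵥ v) ⬝ᵥ w)) • v := by
  unfold rf
  rw [sub_mulVec, one_mulVec, smul_mulVec, vecMulVec_mulVec]
  ext i
  simp
  ring

lemma rf_neg (J : Matrix ι ι ℝ) (v : ι → ℝ) : rf J (-v) = rf J v := by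
  unfold rf
  simp [mulVec_neg, neg_vecMulVec, vecMulVec_neg]

lemma rf_comm (v w : ι → ℝ) (h : v ⬝ᵥ w = 0) : rf 1 v * rf 1 w = rf 1 w * rf 1 v := by
  have h2 : w ⬝ᵥ v = 0 := by rw [dotProduct_comm]; exact h
  unfold rf
  simp only [sub_mul, mul_sub, one_mul, mul_one, Matrix.smul_mul, Matrix.mul_smul,
    one_mulVec, vecMulVec_mul_vecMulVec, h, h2, zero_smul, vecMulVec_zero, smul_zero]
  module

end

section
variable (n : ℕ)


/-- Complexification. -/
abbrev cx (A : Matrix (Fin (2 * n + 1)) (Fin (2 * n + 1)) ℝ) : Matrix (Fin (2 * n + 1)) (Fin (2 * n + 1)) ℂ := A.map Complex.ofReal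

lemma emb_apply (A : Matrix (Fin (2 * n + 1)) (Fin (2 * n + 1)) ℝ) (i j : Fin (2 * n + 1)) :
    embedDconj (2 * n) 1 A i j = (if i ≠ (Fin.last (2 * n)) then 1 else Complex.I) * (A i j : ℂ) *
      (if j ≠ (Fin.last (2 * n)) then 1 else -Complex.I) := by
  have : embedDconj (2 * n) 1 A =
    diagonal (fun i : Fin (2 * n + 1) => if (i : ℕ) < 2 * n then (1 : ℂ) else Complex.I) * cx n A *
    diagonal (fun i : Fin (2 * n + 1) => if (i : ℕ) < 2 * n then (1 : ℂ) else -Complex.I) := rfl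
  rw [this, mul_diagonal, diagonal_mul]
  simp only [lt_iff, map_apply]

lemma emb_norm (A : Matrix (Fin (2 * n + 1)) (Fin (2 * n + 1)) ℝ) (i j : Fin (2 * n + 1)) :
    ‖embedDconj (2 * n) 1 A i j‖ = |A i j| := by
  rw [emb_apply]
  split_ifs <;> simp

lemma emb_block (A : Matrix (Fin (2 * n + 1)) (Fin (2 * n + 1)) ℝ) (hA : ∀ i, i ≠ (Fin.last (2 * n)) → A i (Fin.last (2 * n)) = 0 ∧ A (Fin.last (2 * n)) i = 0) :
    embedDconj (2 * n) 1 A = cx n A := by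
  ext i j
  rw [emb_apply]
  by_cases hi : i = (Fin.last (2 * n)) <;> by_cases hj : j = (Fin.last (2 * n))
  · subst hi; subst hj
    simp
    linear_combination (-(A (Fin.last (2 * n)) (Fin.last (2 * n)) : ℂ)) * Complex.I_mul_I
  · subst hi; simp [(hA j hj).2]
  · subst hj; simp [(hA i hi).1]
  · simp [hi, hj]

lemma emb_continuous : Continuous (embedDconj (2 * n) 1) := by
  apply continuous_matrix
  intro i j
  simp only [emb_apply]
  refine (continuous_const.mul (Complex.continuous_ofReal.comp ?_)).mul continuous_const
  exact continuous_id.matrix_elem i j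

lemma emb_orth (A : Matrix (Fin (2 * n + 1)) (Fin (2 * n + 1)) ℝ) (hA : Aᵀ * J n * A = J n) :
    (embedDconj (2 * n) 1 A)ᵀ * embedDconj (2 * n) 1 A = 1 := by
  have e : (embedDconj (2 * n) 1 A)ᵀ * embedDconj (2 * n) 1 A =
      embedDconj (2 * n) 1 (J n * Aᵀ * J n * A) := by
    rw [map_mul]
    congr 1
    ext i j
    rw [transpose_apply, emb_apply, emb_apply, J_eq, mul_diagonal, diagonal_mul, transpose_apply]
    split_ifs <;> simp [mul_comm]
  have h : J n * Aᵀ * J n * A = 1 := by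
    rw [mul_assoc, mul_assoc, ← mul_assoc Aᵀ, hA, J_sq]
  rw [e, h, map_one]

lemma emb_det (A : Matrix (Fin (2 * n + 1)) (Fin (2 * n + 1)) ℝ) : (embedDconj (2 * n) 1 A).det = (A.det : ℂ) := by
  have : embedDconj (2 * n) 1 A = (Dunit (2 * n) 1 : Matrix (Fin (2 * n + 1)) (Fin (2 * n + 1)) ℂ) * cx n A *
    (((Dunit (2 * n) 1)⁻¹ : (Matrix (Fin (2 * n + 1)) (Fin (2 * n + 1)) ℂ)ˣ) : Matrix (Fin (2 * n + 1)) (Fin (2 * n + 1)) ℂ) := rfl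
  rw [this, det_units_conj]
  exact (RingHom.map_det Complex.ofRealHom A).symm

/-- The embedding of `SO₀(2n,1)` in `SO(2n+1,ℂ)`. -/
def phi : L n →* SOC (2 * n + 1) :=
  MonoidHom.codRestrict ((Units.map (embedDconj (2 * n) 1)).comp
    ((indefO (2 * n) 1).subtype.comp (L n).subtype)) (SOC (2 * n + 1)) (by
      intro h
      refine ⟨emb_orth n _ (R_pres n h), ?_⟩
      change (embedDconj (2 * n) 1 (R n h)).det = 1
      rw [emb_det, det_R]; simp)

lemma phi_val (h : L n) :
    ((phi n h : GL (Fin (2 * n + 1)) ℂ) : Matrix (Fin (2 * n + 1)) (Fin (2 * n + 1)) ℂ) = embedDconj (2 * n) 1 (R n h) := rfl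

lemma phi_range : (phi n).range =
    (Subgroup.map (Units.map (embedDconj (2 * n) 1)) (SOZero (2 * n) 1)).subgroupOf
        (SOC (2 * n + 1)) := by
  ext x
  rw [Subgroup.mem_subgroupOf, MonoidHom.mem_range]
  constructor
  · rintro ⟨h, rfl⟩
    exact ⟨_, ⟨h.1, h.2, rfl⟩, rfl⟩
  · rintro ⟨_, ⟨h, hh, rfl⟩, hx⟩
    exact ⟨⟨h, hh⟩, Subtype.ext hx⟩

lemma phi_continuous : Continuous (phi n) := by
  rw [(isEmbedding_SO n).continuous_iff]
  exact (emb_continuous n).comp (isClosedEmbedding_R n).continuous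

lemma phi_proper (C : Set (SOC (2 * n + 1))) (hC : IsCompact C) : IsCompact (phi n ⁻¹' C) := by
  let f : SOC (2 * n + 1) → Fin (2 * n + 1) → Fin (2 * n + 1) → ℂ := fun A =>
    ((A : GL (Fin (2 * n + 1)) ℂ) : Matrix (Fin (2 * n + 1)) (Fin (2 * n + 1)) ℂ)
  have hf : Continuous f := (isEmbedding_SO n).continuous
  obtain ⟨M, hM⟩ := hC.exists_bound_of_continuousOn hf.continuousOn
  refine (compact_of_bound n M).of_isClosed_subset (hC.isClosed.preimage (phi_continuous n)) ?_
  intro h hh i j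
  rw [← emb_norm, ← phi_val]
  exact (norm_le_pi_norm (f (phi n h) i) j).trans
    ((norm_le_pi_norm (f (phi n h)) i).trans (hM _ hh))

/-- Rotation taking the last basis vector to `2 u_l u - e_l`. -/
def rot (u : Fin (2 * n + 1) → ℝ) : Matrix (Fin (2 * n + 1)) (Fin (2 * n + 1)) ℝ := rf 1 u * rf 1 (Pi.single (Fin.last (2 * n)) 1)

lemma single_unit (i : Fin (2 * n + 1)) :
    (Pi.single i 1 : Fin (2 * n + 1) → ℝ) ⬝ᵥ Pi.single i 1 = 1 := by simp

lemma rot_orth (u : Fin (2 * n + 1) → ℝ) (hu : u ⬝ᵥ u = 1) : (rot n u)ᵀ * rot n u = 1 := by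
  unfold rot
  rw [transpose_mul, rf_transpose_one, rf_transpose_one, mul_assoc, ← mul_assoc (rf 1 u),
    rf_sq 1 u (by rwa [one_mulVec]), one_mul, rf_sq]
  rw [one_mulVec, single_unit]

lemma rot_det (u : Fin (2 * n + 1) → ℝ) (hu : u ⬝ᵥ u = 1) : (rot n u).det = 1 := by
  unfold rot
  rw [det_mul, rf_det u hu, rf_det _ (single_unit n _)]; norm_num

lemma rot_e (u : Fin (2 * n + 1) → ℝ) :
    rot n u *ᵥ Pi.single (Fin.last (2 * n)) 1 = (2 * u (Fin.last (2 * n))) • u - Pi.single (Fin.last (2 * n)) 1 := by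
  unfold rot
  rw [← mulVec_mulVec, rf_mulVec, rf_mulVec, one_mulVec, one_mulVec, single_unit]
  ext i
  simp [dotProduct_sub]
  ring

lemma sphere_dot (u : sphere (0 : EuclideanSpace ℝ (Fin (2 * n + 1))) 1) :
    (u : EuclideanSpace ℝ (Fin (2 * n + 1))).ofLp ⬝ᵥ (u : EuclideanSpace ℝ (Fin (2 * n + 1))).ofLp
      = 1 := by
  have h : ‖(u : EuclideanSpace ℝ (Fin (2 * n + 1)))‖ = 1 := by simp
  have h2 := EuclideanSpace.real_norm_sq_eq (u : EuclideanSpace ℝ (Fin (2 * n + 1)))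
  rw [h] at h2
  simp only [dotProduct]
  simp only [sq] at h2
  linarith

lemma mem_sphere_of_dot (u : Fin (2 * n + 1) → ℝ) (hu : u ⬝ᵥ u = 1) :
    (WithLp.toLp 2 u : EuclideanSpace ℝ (Fin (2 * n + 1))) ∈
      sphere (0 : EuclideanSpace ℝ (Fin (2 * n + 1))) 1 := by
  rw [mem_sphere_zero_iff_norm]
  have h : ‖(WithLp.toLp 2 u : EuclideanSpace ℝ (Fin (2 * n + 1)))‖ ^ 2 = 1 := by
    rw [EuclideanSpace.real_norm_sq_eq, ← hu]
    simp only [dotProduct, sq]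
  exact (pow_eq_one_iff_of_nonneg (norm_nonneg _) two_ne_zero).mp h

/-- The compact family in `SO(2n+1,ℂ)`. -/
def kk (u : sphere (0 : EuclideanSpace ℝ (Fin (2 * n + 1))) 1) : SOC (2 * n + 1) :=
  mkSO n (cx n (rot n u.1.ofLp)) (by
    have := rot_orth n u.1.ofLp (sphere_dot n u)
    have h2 := congrArg (fun A => Complex.ofRealHom.mapMatrix A) this
    simp only [map_mul, map_one] at h2
    exact h2) (by
    have := RingHom.map_det Complex.ofRealHom (rot n u.1.ofLp)
    rw [rot_det n _ (sphere_dot n u)] at this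
    rw [map_one] at this
    exact this.symm)

lemma rot_continuous : Continuous fun u : sphere (0 : EuclideanSpace ℝ (Fin (2 * n + 1))) 1 =>
    rot n u.1.ofLp := by
  unfold rot
  refine Continuous.mul (rf_continuous _ _ ?_) continuous_const
  exact (PiLp.continuous_ofLp 2 _).comp continuous_subtype_val

lemma kk_continuous : Continuous (kk n) := by
  rw [(isEmbedding_SO n).continuous_iff]
  exact (rot_continuous n).matrix_map Complex.continuous_ofReal

lemma rot_surj (hn : 1 ≤ n) (x : EuclideanSpace ℝ (Fin (2 * n + 1))) (hx : ‖x‖ = 1) :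
    ∃ u : sphere (0 : EuclideanSpace ℝ (Fin (2 * n + 1))) 1,
      rot n u.1.ofLp *ᵥ Pi.single (Fin.last (2 * n)) 1 = x.ofLp := by
  have hxx : x.ofLp ⬝ᵥ x.ofLp = 1 := sphere_dot n ⟨x, by simpa using hx⟩
  have h0 : (0 : Fin (2 * n + 1)) ≠ (Fin.last (2 * n)) := by
    rw [Ne, Fin.ext_iff]; simp; omega
  have hsum : x.ofLp ⬝ᵥ x.ofLp = ∑ i ∈ Finset.univ.erase (Fin.last (2 * n)), x.ofLp i * x.ofLp i
      + x.ofLp (Fin.last (2 * n)) * x.ofLp (Fin.last (2 * n)) := (Finset.sum_erase_add _ _ (Finset.mem_univ _)).symm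
  have hle : ∀ i, i ≠ (Fin.last (2 * n)) → x.ofLp i * x.ofLp i + x.ofLp (Fin.last (2 * n)) * x.ofLp (Fin.last (2 * n)) ≤ 1 := by
    intro i hi
    rw [← hxx, hsum]
    have := Finset.single_le_sum (f := fun i => x.ofLp i * x.ofLp i)
      (fun _ _ => mul_self_nonneg _) (Finset.mem_erase.mpr ⟨hi, Finset.mem_univ i⟩)
    simp only at this
    linarith
  by_cases hl : x.ofLp (Fin.last (2 * n)) = -1
  · refine ⟨⟨_, mem_sphere_of_dot n _ (single_unit n 0)⟩, ?_⟩
    rw [rot_e]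
    ext i
    by_cases hi : i = (Fin.last (2 * n))
    · subst hi; simp [h0.symm, hl]
    · have := hle i hi
      rw [hl] at this
      have : x.ofLp i = 0 := by nlinarith
      simp [h0.symm, hi, this]
  · have h1 : 0 < 2 + 2 * x.ofLp (Fin.last (2 * n)) := by
      have := hle 0 h0
      have h2 : -1 ≤ x.ofLp (Fin.last (2 * n)) := by nlinarith [mul_self_nonneg (x.ofLp 0)]
      have : -1 < x.ofLp (Fin.last (2 * n)) := lt_of_le_of_ne h2 (Ne.symm hl)
      linarith
    set s := Real.sqrt (2 + 2 * x.ofLp (Fin.last (2 * n))) with hs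
    have hs2 : s * s = 2 + 2 * x.ofLp (Fin.last (2 * n)) := Real.mul_self_sqrt h1.le
    have hs0 : s ≠ 0 := (Real.sqrt_pos.mpr h1).ne'
    have hd : (s⁻¹ • (x.ofLp + Pi.single (Fin.last (2 * n)) 1)) ⬝ᵥ (s⁻¹ • (x.ofLp + Pi.single (Fin.last (2 * n)) 1)) = 1 := by
      rw [smul_dotProduct, dotProduct_smul, add_dotProduct, dotProduct_add, dotProduct_add, hxx]
      simp
      field_simp
      linarith
    refine ⟨⟨_, mem_sphere_of_dot n _ hd⟩, ?_⟩
    rw [rot_e]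
    ext i
    simp
    field_simp
    linear_combination (-(x.ofLp i + (Pi.single (Fin.last (2 * n)) 1 : Fin (2 * n + 1) → ℝ) i)) * hs2

lemma rf_J_eq (v : Fin (2 * n + 1) → ℝ) (hv : v (Fin.last (2 * n)) = 0) : J n *ᵥ v = v := by
  ext i
  rw [J_eq, mulVec_diagonal]
  split_ifs with h
  · simp
  · push Not at h; subst h; simp [hv]

lemma exists_h (hn : 1 ≤ n) (u₁ u₂ : Fin (2 * n + 1) → ℝ) (h₁ : u₁ ⬝ᵥ u₁ = 1) (h₂ : u₂ ⬝ᵥ u₂ = 1)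
    (hl₁ : u₁ (Fin.last (2 * n)) = 0) (hl₂ : u₂ (Fin.last (2 * n)) = 0) :
    ∃ h : L n, R n h = rf 1 u₁ * rf 1 u₂ := by
  let S := sphere (0 : EuclideanSpace ℝ (Fin (2 * n))) 1
  let v : S → Fin (2 * n + 1) → ℝ := fun w => Fin.snoc (α := fun _ => ℝ) w.1.ofLp 0
  have hv : Continuous v :=
    Continuous.finSnoc ((PiLp.continuous_ofLp 2 _).comp continuous_subtype_val) continuous_const
  have hvl : ∀ w, v w (Fin.last (2 * n)) = 0 := fun w => by simp [v]
  have hS : PreconnectedSpace S := by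
    apply Subtype.preconnectedSpace
    apply isPreconnected_sphere
    rw [← Module.finrank_eq_rank]
    simp
    have : 1 < 2 * n := by omega
    exact_mod_cast this
  have hq : ∀ w, v w ⬝ᵥ J n *ᵥ v w = 1 := by
    intro w
    rw [rf_J_eq n _ (hvl w)]
    have h : ‖(w : EuclideanSpace ℝ (Fin (2 * n)))‖ = 1 := by simp
    have h2 := EuclideanSpace.real_norm_sq_eq (w : EuclideanSpace ℝ (Fin (2 * n)))
    rw [h] at h2
    simp only [dotProduct, Fin.sum_univ_castSucc, v, Fin.snoc_castSucc, Fin.snoc_last]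
    simp only [sq] at h2
    linarith
  have hex : ∀ u : Fin (2 * n + 1) → ℝ, u ⬝ᵥ u = 1 → u (Fin.last (2 * n)) = 0 → ∃ w, v w = u := by
    intro u hu hul
    refine ⟨⟨WithLp.toLp 2 (fun i => u i.castSucc), ?_⟩, ?_⟩
    · rw [mem_sphere_zero_iff_norm]
      have h : ‖(WithLp.toLp 2 (fun i => u i.castSucc) : EuclideanSpace ℝ (Fin (2 * n)))‖ ^ 2
          = 1 := by
        rw [EuclideanSpace.real_norm_sq_eq, ← hu]
        simp only [dotProduct, Fin.sum_univ_castSucc, hul, sq]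
        simp
      exact (pow_eq_one_iff_of_nonneg (norm_nonneg _) two_ne_zero).mp h
    · ext i
      refine Fin.lastCases ?_ (fun i => ?_) i
      · simp [v, hul]
      · simp [v]
  obtain ⟨w₁, e₁⟩ := hex u₁ h₁ hl₁
  obtain ⟨w₂, e₂⟩ := hex u₂ h₂ hl₂
  obtain ⟨h, hh⟩ := mem_L n v hv hq w₁ w₂
  refine ⟨h, ?_⟩
  rw [hh, e₁, e₂]
  unfold rf
  rw [rf_J_eq n _ hl₁, rf_J_eq n _ hl₂, one_mulVec, one_mulVec]

lemma rot_fib (hn : 1 ≤ n) (u₁ u₂ : sphere (0 : EuclideanSpace ℝ (Fin (2 * n + 1))) 1)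
    (he : rot n u₁.1.ofLp *ᵥ Pi.single (Fin.last (2 * n)) 1 = rot n u₂.1.ofLp *ᵥ Pi.single (Fin.last (2 * n)) 1) :
    ∃ h, kk n u₂ = kk n u₁ * phi n h ∧ rot n u₂.1.ofLp = rot n u₁.1.ofLp * R n h ∧
        ∀ i, i ≠ (Fin.last (2 * n)) → R n h i (Fin.last (2 * n)) = 0 ∧ R n h (Fin.last (2 * n)) i = 0 := by
  suffices H : ∃ h, rot n u₂.1.ofLp = rot n u₁.1.ofLp * R n h ∧
        ∀ i, i ≠ (Fin.last (2 * n)) → R n h i (Fin.last (2 * n)) = 0 ∧ R n h (Fin.last (2 * n)) i = 0 by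
    obtain ⟨h, h1, h2⟩ := H
    refine ⟨h, ?_, h1, h2⟩
    apply (isEmbedding_SO n).injective
    change cx n (rot n u₂.1.ofLp) = cx n (rot n u₁.1.ofLp) * embedDconj (2 * n) 1 (R n h)
    rw [emb_block n _ h2, h1]
    exact map_mul (Complex.ofRealHom.mapMatrix : Matrix (Fin (2 * n + 1)) (Fin (2 * n + 1)) ℝ →+* Matrix (Fin (2 * n + 1)) (Fin (2 * n + 1)) ℂ) _ _
  have d1 := sphere_dot n u₁
  have d2 := sphere_dot n u₂
  generalize u₁.1.ofLp = a at *
  generalize u₂.1.ofLp = b at *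
  rw [rot_e, rot_e] at he
  have he2 : (2 * a (Fin.last (2 * n))) • a = (2 * b (Fin.last (2 * n))) • b := sub_left_injective he
  have hab : a (Fin.last (2 * n)) * a (Fin.last (2 * n)) = b (Fin.last (2 * n)) * b (Fin.last (2 * n)) := by
    have := congrFun he2 (Fin.last (2 * n))
    simp at this
    linarith
  by_cases ha : a (Fin.last (2 * n)) = 0
  · have hb : b (Fin.last (2 * n)) = 0 := by
      rw [ha] at hab; simp at hab; exact hab
    obtain ⟨h, hh⟩ := exists_h n hn a b d1 d2 ha hb
    refine ⟨h, ?_, ?_⟩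
    · have c1 : rf 1 (Pi.single (Fin.last (2 * n)) 1) * rf 1 a = rf 1 a * rf 1 (Pi.single (Fin.last (2 * n)) 1) :=
        rf_comm _ _ (by simp [ha])
      have c2 : rf 1 (Pi.single (Fin.last (2 * n)) 1) * rf 1 b = rf 1 b * rf 1 (Pi.single (Fin.last (2 * n)) 1) :=
        rf_comm _ _ (by simp [hb])
      rw [hh]
      unfold rot
      rw [mul_assoc, ← mul_assoc _ (rf 1 a), c1, mul_assoc (rf 1 a), c2, ← mul_assoc (rf 1 a),
        rf_sq 1 a (by rwa [one_mulVec]), one_mul]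
    · have f1 : rf 1 a *ᵥ Pi.single (Fin.last (2 * n)) 1 = Pi.single (Fin.last (2 * n)) 1 := by
        rw [rf_mulVec, one_mulVec]; simp [ha]
      have f2 : rf 1 b *ᵥ Pi.single (Fin.last (2 * n)) 1 = Pi.single (Fin.last (2 * n)) 1 := by
        rw [rf_mulVec, one_mulVec]; simp [hb]
      have g1 : R n h *ᵥ Pi.single (Fin.last (2 * n)) 1 = Pi.single (Fin.last (2 * n)) 1 := by
        rw [hh, ← mulVec_mulVec, f2, f1]
      have g2 : (R n h)ᵀ *ᵥ Pi.single (Fin.last (2 * n)) 1 = Pi.single (Fin.last (2 * n)) 1 := by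
        rw [hh, transpose_mul, rf_transpose_one, rf_transpose_one, ← mulVec_mulVec, f1, f2]
      intro i hi
      rw [mulVec_single_one] at g1 g2
      have k1 := congrFun g1 i
      have k2 := congrFun g2 i
      simp [hi] at k1 k2
      exact ⟨k1, k2⟩
  · have hcase : b = a ∨ b = -a := by
      rcases mul_self_eq_mul_self_iff.mp hab with h | h
      · left
        rw [← h] at he2
        exact (smul_right_injective _ (mul_ne_zero two_ne_zero ha) he2).symm
      · right
        have hb : b (Fin.last (2 * n)) = - a (Fin.last (2 * n)) := by linarith
        rw [hb, mul_neg, neg_smul, ← smul_neg] at he2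
        have := smul_right_injective _ (mul_ne_zero two_ne_zero ha) he2
        simp only at this
        rw [this, neg_neg]
    refine ⟨1, ?_, ?_⟩
    · rw [map_one, mul_one]
      unfold rot
      rcases hcase with h | h
      · rw [h]
      · rw [h, rf_neg]
    · intro i hi
      rw [map_one]
      exact ⟨one_apply_ne hi, one_apply_ne (Ne.symm hi)⟩

lemma boosts (hn : 1 ≤ n) (M : ℝ) : ∃ h, M < R n h (Fin.last (2 * n)) (Fin.last (2 * n)) := by
  have h0 : (0 : Fin (2 * n + 1)) ≠ (Fin.last (2 * n)) := by
    rw [Ne, Fin.ext_iff]; simp; omega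
  let v : ℝ → Fin (2 * n + 1) → ℝ := fun s =>
    Real.cosh s • Pi.single 0 1 + Real.sinh s • Pi.single (Fin.last (2 * n)) 1
  have hv : Continuous v := by
    exact (Real.continuous_cosh.smul continuous_const).add
      (Real.continuous_sinh.smul continuous_const)
  have hJv : ∀ s, J n *ᵥ v s = Real.cosh s • Pi.single 0 1 - Real.sinh s • Pi.single (Fin.last (2 * n)) 1 := by
    intro s
    ext i
    rw [J_eq, mulVec_diagonal]
    by_cases hi : i = (Fin.last (2 * n))
    · subst hi; simp [v, h0.symm]
    · simp [v, hi]
  have hq : ∀ s, v s ⬝ᵥ J n *ᵥ v s = 1 := by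
    intro s
    rw [hJv]
    simp [v, add_dotProduct, h0, h0.symm]
    have := Real.cosh_sq s
    nlinarith
  obtain ⟨h, hh⟩ := mem_L n v hv hq (Real.arsinh M) 0
  refine ⟨h, ?_⟩
  have e1 : R n h *ᵥ Pi.single (Fin.last (2 * n)) 1 = rf (J n) (v (Real.arsinh M)) *ᵥ Pi.single (Fin.last (2 * n)) 1 := by
    rw [hh, ← mulVec_mulVec, rf_mulVec _ (v 0), hJv]
    simp [h0.symm]
  have e2 : R n h (Fin.last (2 * n)) (Fin.last (2 * n)) = 1 + 2 * M * M := by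
    have := congrFun e1 (Fin.last (2 * n))
    rw [mulVec_single_one, rf_mulVec, hJv] at this
    simp [v, h0.symm, sub_dotProduct, Real.sinh_arsinh] at this
    rw [this]
  rw [e2]
  nlinarith [sq_nonneg (M - 1), sq_nonneg M]

theorem main (hn : 1 ≤ n) (Γ : Subgroup (SOC (2 * n + 1)))
    (hp : ProperlyDiscontinuousSMul Γ (SOC (2 * n + 1) ⧸ (phi n).range))
    (hc : CompactSpace (Quotient (MulAction.orbitRel Γ (SOC (2 * n + 1) ⧸ (phi n).range)))) :
    False := by
  letI : MeasurableSpace (L n) := borel _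
  haveI : BorelSpace (L n) := ⟨rfl⟩
  exact CK.no_form (phi n) (phi_continuous n) (phi_proper n) ⟨n, rfl⟩ (R n)
    (isClosedEmbedding_R n).continuous (Fin.last (2 * n)) (one_le_R n) (R_bound n) (boosts n hn) (kk n)
    (kk_continuous n) (fun u => rot n u.1.ofLp) (rot_continuous n)
    (fun u => rot_orth n _ (sphere_dot n u)) (rot_surj n hn) (rot_fib n hn) Γ hp hc

end
end DD

/-- For every integer `n ≥ 1`, the irreducible symmetric space
`SO(2n+1,ℂ)/SO₀(2n,1)` does not admit a compact Clifford–Klein form; here `SO₀(2n,1)` is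
embedded into `SO(2n+1,ℂ)` via `A ↦ D A D⁻¹` with `D = diag(1_{2n}, √−1)`. -/
theorem statement7 (n : ℕ) (hn : 1 ≤ n) :
    ¬ AdmitsCompactCliffordKleinForm
      ((Subgroup.map (Units.map (embedDconj (2 * n) 1)) (SOZero (2 * n) 1)).subgroupOf
        (SOC (2 * n + 1))) := by
  rintro ⟨Γ, -, hp, -, hc⟩
  rw [← DD.phi_range] at hp hc
  exact DD.main n hn Γ hp hc

end
end
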